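/- arXiv:gr-qc/9906087 — 5 statements merged into one kernel-verified Lean document; each statement's English description precedes it below -/
import Mathlib

section
/- Let 1 ≤ p ≤ n and 1 ≤ q ≤ n. For every double (p,q)-form K on n-dimensional Minkowski space and all future-pointing causal vectors k₁, k₂, k₃, k₄, the basic super-energy tensor of K satisfies T{K}_{αβλμ} k₁^α k₂^β k₃^λ k₄^μ ≥ 0 (the dominant super-energy property for double forms). -/
open Finset

noncomputable section

/-- Components of the Minkowski metric (and of its inverse) in dimension `n`. -/
def gmet (n : ℕ) (μ ν : Fin n) : ℝ :=
  if μ = ν then (if (μ : ℕ) = 0 then -1 else 1) else 0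

/-- Minkowski square `η_{μν} v^μ v^ν` of a vector. -/
def minkSq (n : ℕ) (v : Fin n → ℝ) : ℝ :=
  ∑ μ : Fin n, ∑ ν : Fin n, gmet n μ ν * v μ * v ν

/-- A double `(p,q)`-form: totally antisymmetric in each of the two blocks of indices. -/
def IsDoubleForm (n p q : ℕ) (K : (Fin p → Fin n) → (Fin q → Fin n) → ℝ) : Prop :=
  (∀ (π : Equiv.Perm (Fin p)) (ρ : Fin p → Fin n) (σ : Fin q → Fin n),
      K (ρ ∘ π) σ = ((Equiv.Perm.sign π : ℤ) : ℝ) * K ρ σ) ∧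
  (∀ (π : Equiv.Perm (Fin q)) (ρ : Fin p → Fin n) (σ : Fin q → Fin n),
      K ρ (σ ∘ π) = ((Equiv.Perm.sign π : ℤ) : ℝ) * K ρ σ)

/-- The contraction `K_{αρ₂…ρ_p,λσ₂…σ_q} K_β{}^{ρ₂…ρ_p}{}_μ{}^{σ₂…σ_q}`. -/
def dCon11 (n p q : ℕ) (hp : 0 < p) (hq : 0 < q)
    (K : (Fin p → Fin n) → (Fin q → Fin n) → ℝ) (α β lam mu : Fin n) : ℝ :=
  ∑ ρ : Fin p → Fin n, ∑ ρ' : Fin p → Fin n, ∑ σ : Fin q → Fin n, ∑ σ' : Fin q → Fin n,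
    if ρ ⟨0, hp⟩ = α ∧ ρ' ⟨0, hp⟩ = β ∧ σ ⟨0, hq⟩ = lam ∧ σ' ⟨0, hq⟩ = mu then
      K ρ σ * K ρ' σ' *
        (∏ i ∈ Finset.univ.filter (fun i => i ≠ (⟨0, hp⟩ : Fin p)), gmet n (ρ i) (ρ' i)) *
        (∏ j ∈ Finset.univ.filter (fun j => j ≠ (⟨0, hq⟩ : Fin q)), gmet n (σ j) (σ' j))
    else 0

/-- The contraction `K_{ρ₁…ρ_p,λσ₂…σ_q} K^{ρ₁…ρ_p}{}_μ{}^{σ₂…σ_q}`. -/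
def dCon01 (n p q : ℕ) (hq : 0 < q)
    (K : (Fin p → Fin n) → (Fin q → Fin n) → ℝ) (lam mu : Fin n) : ℝ :=
  ∑ ρ : Fin p → Fin n, ∑ ρ' : Fin p → Fin n, ∑ σ : Fin q → Fin n, ∑ σ' : Fin q → Fin n,
    if σ ⟨0, hq⟩ = lam ∧ σ' ⟨0, hq⟩ = mu then
      K ρ σ * K ρ' σ' *
        (∏ i : Fin p, gmet n (ρ i) (ρ' i)) *
        (∏ j ∈ Finset.univ.filter (fun j => j ≠ (⟨0, hq⟩ : Fin q)), gmet n (σ j) (σ' j))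
    else 0

/-- The contraction `K_{αρ₂…ρ_p,σ₁…σ_q} K_β{}^{ρ₂…ρ_p,σ₁…σ_q}`. -/
def dCon10 (n p q : ℕ) (hp : 0 < p)
    (K : (Fin p → Fin n) → (Fin q → Fin n) → ℝ) (α β : Fin n) : ℝ :=
  ∑ ρ : Fin p → Fin n, ∑ ρ' : Fin p → Fin n, ∑ σ : Fin q → Fin n, ∑ σ' : Fin q → Fin n,
    if ρ ⟨0, hp⟩ = α ∧ ρ' ⟨0, hp⟩ = β then
      K ρ σ * K ρ' σ' *
        (∏ i ∈ Finset.univ.filter (fun i => i ≠ (⟨0, hp⟩ : Fin p)), gmet n (ρ i) (ρ' i)) *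
        (∏ j : Fin q, gmet n (σ j) (σ' j))
    else 0

/-- The full contraction `K_{ρ₁…ρ_p,σ₁…σ_q} K^{ρ₁…ρ_p,σ₁…σ_q}`. -/
def dCon00 (n p q : ℕ) (K : (Fin p → Fin n) → (Fin q → Fin n) → ℝ) : ℝ :=
  ∑ ρ : Fin p → Fin n, ∑ ρ' : Fin p → Fin n, ∑ σ : Fin q → Fin n, ∑ σ' : Fin q → Fin n,
    K ρ σ * K ρ' σ' *
      (∏ i : Fin p, gmet n (ρ i) (ρ' i)) * (∏ j : Fin q, gmet n (σ j) (σ' j))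

/-- The basic super-energy tensor `T{K}_{αβλμ}` of a double `(p,q)`-form. -/
def seTK (n p q : ℕ) (hp : 0 < p) (hq : 0 < q)
    (K : (Fin p → Fin n) → (Fin q → Fin n) → ℝ) (α β lam mu : Fin n) : ℝ :=
  (1 / (((p - 1).factorial : ℝ) * ((q - 1).factorial : ℝ))) *
    (dCon11 n p q hp hq K α β lam mu + dCon11 n p q hp hq K α β mu lam
      - (1 / (p : ℝ)) * gmet n α β * dCon01 n p q hq K lam mu
      - (1 / (q : ℝ)) * gmet n lam mu * dCon10 n p q hp K α β
      + (1 / (2 * (p : ℝ) * (q : ℝ))) * gmet n α β * gmet n lam mu * dCon00 n p q K)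


section gen
variable {n : ℕ} {V : Type*} [AddCommGroup V] [Module ℝ V]

/-- Slice of a tensor: fix the first index. -/
def sl {p : ℕ} (a : Fin n) (F : (Fin (p+1) → Fin n) → V) : (Fin p → Fin n) → V :=
  fun ρ => F (Fin.cons a ρ)

/-- Contraction with a vector in the first slot. -/
def ctr {p : ℕ} (u : Fin n → ℝ) (F : (Fin (p+1) → Fin n) → V) : (Fin p → Fin n) → V :=
  ∑ a, u a • sl a F

def Anti {p : ℕ} (F : (Fin p → Fin n) → V) : Prop :=
  ∀ (π : Equiv.Perm (Fin p)) (ρ : Fin p → Fin n),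
    F (ρ ∘ π) = ((Equiv.Perm.sign π : ℤ) : ℝ) • F ρ

/-- Full contraction of two tensors. -/
def CC (g : Fin n → Fin n → ℝ) (b : V →ₗ[ℝ] V →ₗ[ℝ] ℝ) {p : ℕ}
    (F G : (Fin p → Fin n) → V) : ℝ :=
  ∑ ρ, ∑ ρ', (∏ i, g (ρ i) (ρ' i)) * b (F ρ) (G ρ')

lemma sum_tuple {p : ℕ} {M : Type*} [AddCommMonoid M] (f : (Fin (p+1) → Fin n) → M) :
    ∑ ρ, f ρ = ∑ a : Fin n, ∑ ρ : Fin p → Fin n, f (Fin.cons a ρ) := by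
  rw [← (Fin.consEquiv (fun _ : Fin (p+1) => Fin n)).sum_comp, Fintype.sum_prod_type]
  rfl

lemma CC_succ (g : Fin n → Fin n → ℝ) (b : V →ₗ[ℝ] V →ₗ[ℝ] ℝ) {p : ℕ}
    (F G : (Fin (p+1) → Fin n) → V) :
    CC g b F G = ∑ a, ∑ c, g a c * CC g b (sl a F) (sl c G) := by
  unfold CC sl
  rw [sum_tuple]
  refine Finset.sum_congr rfl fun a _ => ?_
  simp_rw [sum_tuple (p := p)]
  rw [Finset.sum_comm]
  refine Finset.sum_congr rfl fun c _ => ?_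
  simp [Fin.prod_univ_succ, Finset.mul_sum, mul_assoc]

lemma CC_add_left (g : Fin n → Fin n → ℝ) (b : V →ₗ[ℝ] V →ₗ[ℝ] ℝ) {p : ℕ}
    (F F' G : (Fin p → Fin n) → V) : CC g b (F + F') G = CC g b F G + CC g b F' G := by
  simp [CC, mul_add, Finset.sum_add_distrib]

lemma CC_add_right (g : Fin n → Fin n → ℝ) (b : V →ₗ[ℝ] V →ₗ[ℝ] ℝ) {p : ℕ}
    (F G G' : (Fin p → Fin n) → V) : CC g b F (G + G') = CC g b F G + CC g b F G' := by
  simp [CC, mul_add, Finset.sum_add_distrib]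

lemma CC_smul_left (g : Fin n → Fin n → ℝ) (b : V →ₗ[ℝ] V →ₗ[ℝ] ℝ) {p : ℕ} (c : ℝ)
    (F G : (Fin p → Fin n) → V) : CC g b (c • F) G = c * CC g b F G := by
  simp [CC, Finset.mul_sum, mul_left_comm]

lemma CC_smul_right (g : Fin n → Fin n → ℝ) (b : V →ₗ[ℝ] V →ₗ[ℝ] ℝ) {p : ℕ} (c : ℝ)
    (F G : (Fin p → Fin n) → V) : CC g b F (c • G) = c * CC g b F G := by
  simp [CC, Finset.mul_sum, mul_left_comm]

/-- `CC` as a bilinear map. -/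
def CCb (g : Fin n → Fin n → ℝ) (b : V →ₗ[ℝ] V →ₗ[ℝ] ℝ) (p : ℕ) :
    ((Fin p → Fin n) → V) →ₗ[ℝ] ((Fin p → Fin n) → V) →ₗ[ℝ] ℝ :=
  LinearMap.mk₂ ℝ (CC g b) (CC_add_left g b) (CC_smul_left g b) (CC_add_right g b)
    (CC_smul_right g b)

lemma CC_eq (g : Fin n → Fin n → ℝ) (b : V →ₗ[ℝ] V →ₗ[ℝ] ℝ) {p : ℕ}
    (F G : (Fin p → Fin n) → V) : CC g b F G = CCb g b p F G := rfl

lemma CC_ctr (g : Fin n → Fin n → ℝ) (b : V →ₗ[ℝ] V →ₗ[ℝ] ℝ) {p : ℕ} (u v : Fin n → ℝ)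
    (F G : (Fin (p+1) → Fin n) → V) :
    CC g b (ctr u F) (ctr v G) = ∑ a, ∑ c, u a * v c * CC g b (sl a F) (sl c G) := by
  simp only [CC_eq, ctr, map_sum, LinearMap.sum_apply, map_smul, LinearMap.smul_apply,
    smul_eq_mul, Finset.mul_sum]
  rw [Finset.sum_comm]
  refine Finset.sum_congr rfl fun a _ => Finset.sum_congr rfl fun c _ => ?_
  ring

lemma CC_symm (g : Fin n → Fin n → ℝ) (hg : ∀ a c, g a c = g c a) (b : V →ₗ[ℝ] V →ₗ[ℝ] ℝ)
    (hb : ∀ x y, b x y = b y x) {p : ℕ}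
    (F G : (Fin p → Fin n) → V) : CC g b F G = CC g b G F := by
  unfold CC
  rw [Finset.sum_comm]
  refine Finset.sum_congr rfl fun a _ => Finset.sum_congr rfl fun c _ => ?_
  rw [hb]; congr 1
  exact Finset.prod_congr rfl fun i _ => hg _ _

lemma CC_neg_neg (g : Fin n → Fin n → ℝ) (b : V →ₗ[ℝ] V →ₗ[ℝ] ℝ) {p : ℕ}
    (F G : (Fin p → Fin n) → V) : CC g b (-F) (-G) = CC g b F G := by
  simp [CC_eq]

lemma CC_neg_left (g : Fin n → Fin n → ℝ) (b : V →ₗ[ℝ] V →ₗ[ℝ] ℝ) {p : ℕ}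
    (F G : (Fin p → Fin n) → V) : CC g b (-F) (G) = - CC g b F G := by
  simp [CC_eq]

lemma CC_neg_right (g : Fin n → Fin n → ℝ) (b : V →ₗ[ℝ] V →ₗ[ℝ] ℝ) {p : ℕ}
    (F G : (Fin p → Fin n) → V) : CC g b (F) (-G) = - CC g b F G := by
  simp [CC_eq]

lemma CC_zero_left (g : Fin n → Fin n → ℝ) (b : V →ₗ[ℝ] V →ₗ[ℝ] ℝ) {p : ℕ}
    (G : (Fin p → Fin n) → V) : CC g b 0 (G) = 0 := by
  simp [CC_eq]

lemma CC_scale (g : Fin n → Fin n → ℝ) (s : ℝ) (b : V →ₗ[ℝ] V →ₗ[ℝ] ℝ) {p : ℕ}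
    (F G : (Fin p → Fin n) → V) : CC (fun a c => s * g a c) b F G = s ^ p * CC g b F G := by
  simp [CC, Finset.prod_mul_distrib, Finset.mul_sum, mul_assoc]

lemma Anti.sl {p : ℕ} {F : (Fin (p+1) → Fin n) → V} (hF : Anti F) (a : Fin n) :
    Anti (sl a F) := by
  intro π ρ
  have := hF (Equiv.Perm.decomposeFin.symm (0, π)) (Fin.cons a ρ)
  simp only [Equiv.Perm.decomposeFin.symm_sign] at this
  unfold _root_.sl
  convert this using 2
  · funext i
    refine Fin.cases ?_ (fun j => ?_) i <;> simp
  · simp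

lemma Anti.swap {p : ℕ} {F : (Fin (p+2) → Fin n) → V} (hF : Anti F) (a c : Fin n) :
    _root_.sl a (_root_.sl c F) = - _root_.sl c (_root_.sl a F) := by
  funext ρ
  have := hF (Equiv.swap 0 1) (Fin.cons a (Fin.cons c ρ))
  rw [Equiv.Perm.sign_swap (by simp)] at this
  simp only [_root_.sl, Pi.neg_apply]
  convert this using 2
  · funext i
    refine Fin.cases ?_ (fun j => ?_) i
    · rw [Function.comp_apply, Equiv.swap_apply_left]; rfl
    · refine Fin.cases ?_ (fun k => ?_) j
      · change _ = (Fin.cons a (Fin.cons c ρ) : Fin (p+2) → Fin n) ((Equiv.swap 0 1) 1)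
        rw [Equiv.swap_apply_right]; rfl
      · rw [Function.comp_apply, Equiv.swap_apply_of_ne_of_ne]
        · simp
        · simp
        · intro h
          have := congrArg Fin.val h
          simp at this
  · simp

lemma Anti.ctr {p : ℕ} {F : (Fin (p+1) → Fin n) → V} (hF : Anti F) (u : Fin n → ℝ) :
    Anti (ctr u F) := by
  intro π ρ
  simp only [_root_.ctr, Finset.sum_apply, Pi.smul_apply, Finset.smul_sum]
  refine Finset.sum_congr rfl fun a _ => ?_
  rw [hF.sl a π ρ, smul_comm]

lemma sl_ctr {p : ℕ} (a : Fin n) (u : Fin n → ℝ) (F : (Fin (p+2) → Fin n) → V) :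
    sl a (ctr u F) = ∑ c, u c • sl a (sl c F) := by
  funext ρ
  simp [sl, ctr]

lemma Anti.ctr_sl {p : ℕ} {F : (Fin (p+2) → Fin n) → V} (hF : Anti F) (a : Fin n)
    (u : Fin n → ℝ) : _root_.ctr u (_root_.sl a F) = - _root_.sl a (_root_.ctr u F) := by
  rw [sl_ctr, _root_.ctr, ← Finset.sum_neg_distrib]
  refine Finset.sum_congr rfl fun c _ => ?_
  rw [hF.swap, smul_neg]

lemma Anti.ctr_ctr {p : ℕ} {F : (Fin (p+2) → Fin n) → V} (hF : Anti F)
    (u v : Fin n → ℝ) :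
    _root_.ctr u (_root_.ctr v F) = - _root_.ctr v (_root_.ctr u F) := by
  have e : ∀ w z : Fin n → ℝ, _root_.ctr w (_root_.ctr z F) =
      ∑ a, ∑ c, (w a * z c) • _root_.sl a (_root_.sl c F) := by
    intro w z
    rw [_root_.ctr]
    simp only [sl_ctr, Finset.smul_sum, smul_smul]
  rw [e, e, Finset.sum_comm, ← Finset.sum_neg_distrib]
  refine Finset.sum_congr rfl fun a _ => ?_
  rw [← Finset.sum_neg_distrib]
  refine Finset.sum_congr rfl fun c _ => ?_
  rw [hF.swap, smul_neg, mul_comm]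

lemma eq_zero_of_eq_neg {W : Type*} [AddCommGroup W] [Module ℝ W] {x : W} (h : x = -x) :
    x = 0 := by
  have h2 : (2:ℝ) • x = 0 := by rw [two_smul]; nth_rewrite 2 [h]; simp
  simpa using h2

lemma Anti.ctr_self {p : ℕ} {F : (Fin (p+2) → Fin n) → V} (hF : Anti F)
    (u : Fin n → ℝ) : _root_.ctr u (_root_.ctr u F) = 0 := by
  have h := hF.ctr_ctr u u
  exact eq_zero_of_eq_neg h

lemma ctr_neg {p : ℕ} (u : Fin n → ℝ) (F : (Fin (p+1) → Fin n) → V) :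
    ctr u (-F) = - ctr u F := by
  simp only [ctr, ← Finset.sum_neg_distrib]
  refine Finset.sum_congr rfl fun a _ => ?_
  rw [← smul_neg]; rfl

def X1 (h : Fin n → Fin n → ℝ) (b : V →ₗ[ℝ] V →ₗ[ℝ] ℝ) (u v : Fin n → ℝ) :
    (p : ℕ) → ((Fin p → Fin n) → V) → ((Fin p → Fin n) → V) → ℝ
  | 0, _, _ => 0
  | _ + 1, F, G => CC h b (ctr u F) (ctr v G) + CC h b (ctr v F) (ctr u G)

def X2 (h : Fin n → Fin n → ℝ) (b : V →ₗ[ℝ] V →ₗ[ℝ] ℝ) (u v : Fin n → ℝ) :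
    (p : ℕ) → ((Fin p → Fin n) → V) → ((Fin p → Fin n) → V) → ℝ
  | 0, _, _ => 0
  | 1, _, _ => 0
  | _ + 2, F, G => CC h b (ctr v (ctr u F)) (ctr v (ctr u G))

lemma sumX1 (h : Fin n → Fin n → ℝ) (b : V →ₗ[ℝ] V →ₗ[ℝ] ℝ) (u v : Fin n → ℝ) (p : ℕ)
    {F G : (Fin (p+2) → Fin n) → V} (hF : Anti F) (hG : Anti G) :
    ∑ a, ∑ c, h a c * X1 h b u v (p+1) (sl a F) (sl c G) = X1 h b u v (p+2) F G := by
  simp only [X1, hF.ctr_sl, hG.ctr_sl, CC_neg_neg, mul_add, Finset.sum_add_distrib]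
  rw [← CC_succ, ← CC_succ]

lemma sumX2 (h : Fin n → Fin n → ℝ) (b : V →ₗ[ℝ] V →ₗ[ℝ] ℝ) (u v : Fin n → ℝ) (p : ℕ)
    {F G : (Fin (p+3) → Fin n) → V} (hF : Anti F) (hG : Anti G) :
    ∑ a, ∑ c, h a c * X2 h b u v (p+2) (sl a F) (sl c G) = X2 h b u v (p+3) F G := by
  simp only [X2, hF.ctr_sl, hG.ctr_sl, ctr_neg, (hF.ctr u).ctr_sl, (hG.ctr u).ctr_sl, neg_neg]
  rw [← CC_succ]

lemma key (h : Fin n → Fin n → ℝ) (b : V →ₗ[ℝ] V →ₗ[ℝ] ℝ) (u v : Fin n → ℝ) :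
    ∀ (p : ℕ) (F G : (Fin p → Fin n) → V), Anti F → Anti G →
    CC (fun a c => h a c - u a * v c - v a * u c) b F G =
      CC h b F G - p * X1 h b u v p F G - p * (p - 1) * X2 h b u v p F G := by
  intro p
  induction p with
  | zero => intro F G _ _; simp [CC, X1, X2]
  | succ p ih =>
    intro F G hF hG
    rw [CC_succ]
    simp only [sub_mul, Finset.sum_sub_distrib]
    rw [← CC_ctr, ← CC_ctr, ih _ _ (hF.ctr u) (hG.ctr v), ih _ _ (hF.ctr v) (hG.ctr u)]
    simp only [ih _ _ (hF.sl _) (hG.sl _), mul_sub, Finset.sum_sub_distrib, ← CC_succ]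
    have e1 : ∀ (x : ℝ) (f : Fin n → Fin n → ℝ), ∑ a, ∑ c, h a c * (x * f a c)
        = x * ∑ a, ∑ c, h a c * f a c := by
      intro x f
      simp only [Finset.mul_sum, mul_left_comm]
    match p with
    | 0 => simp [X1, X2, CC_succ]; ring
    | 1 =>
      rw [e1, e1, sumX1 h b u v 0 hF hG]
      simp only [X1, X2, hF.ctr_self, hG.ctr_self, CC_zero_left, hG.ctr_ctr u v,
        hF.ctr_ctr u v, CC_neg_right, CC_neg_left]
      push_cast
      simp
      ring
    | p+2 =>
      rw [e1, e1, sumX1 h b u v (p+1) hF hG, sumX2 h b u v p hF hG]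
      simp only [X1, X2, hF.ctr_self, hG.ctr_self, CC_zero_left, hG.ctr_ctr u v,
        hF.ctr_ctr u v, CC_neg_right, CC_neg_left, ctr_neg, (hF.ctr u).ctr_self, neg_zero]
      push_cast
      have z : ctr v (0 : (Fin (p+1) → Fin n) → V) = 0 := by
        have := ctr_neg v (0 : (Fin (p+1) → Fin n) → V)
        rw [neg_zero] at this
        exact eq_zero_of_eq_neg this
      simp only [z, CC_zero_left]
      ring

lemma CC_nonneg {ι : Type*} [Fintype ι] (B : ι → Fin n → ℝ) (b : V →ₗ[ℝ] V →ₗ[ℝ] ℝ)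
    (P : Submodule ℝ V) (hP : ∀ x ∈ P, 0 ≤ b x x) : ∀ (p : ℕ) (F : (Fin p → Fin n) → V),
    (∀ ρ, F ρ ∈ P) → 0 ≤ CC (fun a c => ∑ i, B i a * B i c) b F F := by
  intro p
  induction p with
  | zero => intro F hF; simp [CC]; exact hP _ (hF _)
  | succ p ih =>
    intro F hF
    rw [CC_succ]
    have : ∑ a, ∑ c, (∑ i, B i a * B i c) * CC (fun a c => ∑ i, B i a * B i c) b (sl a F) (sl c F)
      = ∑ i, CC (fun a c => ∑ i, B i a * B i c) b (ctr (B i) F) (ctr (B i) F) := by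
      simp only [CC_ctr, Finset.sum_mul]
      rw [Finset.sum_comm]
      simp only [Finset.sum_comm (t := (Finset.univ : Finset ι))]
      refine Finset.sum_congr rfl fun i _ => ?_
      rw [Finset.sum_comm]
    rw [this]
    refine Finset.sum_nonneg fun i _ => ih _ fun ρ => ?_
    simp only [ctr, Finset.sum_apply, Pi.smul_apply]
    exact P.sum_mem fun a _ => P.smul_mem _ (hF _)

/-- The general identity: positivity from positivity of `h = s g + u v + v u`. -/
lemma Q_nonneg_of (g : Fin n → Fin n → ℝ) (s : ℝ) (hs : 0 < s) (u v : Fin n → ℝ)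
    (hg : ∀ a c, g a c = g c a)
    (hh : ∀ x : Fin n → ℝ, 0 ≤ ∑ a, ∑ c, (s * g a c + u a * v c + v a * u c) * x a * x c)
    (b : V →ₗ[ℝ] V →ₗ[ℝ] ℝ) (hb : ∀ x y, b x y = b y x)
    (P : Submodule ℝ V) (hP : ∀ x ∈ P, 0 ≤ b x x) (m : ℕ) (F : (Fin (m+1) → Fin n) → V)
    (hF : Anti F) (hFP : ∀ ρ, F ρ ∈ P) :
    0 ≤ CC g b (ctr u F) (ctr v F) + s / (2 * (m + 1 : ℝ)) * CC g b F F := by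
  set h : Fin n → Fin n → ℝ := fun a c => s * g a c + u a * v c + v a * u c with hdef
  obtain ⟨_, B, hB⟩ : ∃ (k : ℕ) (B : Fin k → Fin n → ℝ), h = fun a c => ∑ i, B i a * B i c := by
    have : (Matrix.of h).PosSemidef := by
      refine Matrix.PosSemidef.of_dotProduct_mulVec_nonneg ?_ ?_
      · ext a c
        simp only [Matrix.conjTranspose_apply, Matrix.of_apply, hdef, hg a c, star_trivial]
        ring
      · intro x
        refine (hh x).trans_eq ?_
        simp only [dotProduct, Matrix.mulVec, Finset.mul_sum]
        refine Finset.sum_congr rfl fun a _ => Finset.sum_congr rfl fun c _ => ?_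
        simp [hdef]; ring
    obtain ⟨k, B, hB⟩ := Matrix.posSemidef_iff_eq_sum_vecMulVec.mp this
    refine ⟨k, B, ?_⟩
    funext a c
    have := congrFun (congrFun hB a) c
    simpa [Matrix.sum_apply, Matrix.vecMulVec_apply] using this
  have hctr : ∀ {k : ℕ} (w : Fin n → ℝ) (G : (Fin (k+1) → Fin n) → V), (∀ ρ, G ρ ∈ P) →
      ∀ ρ, ctr w G ρ ∈ P := by
    intro k w G hG ρ
    simp only [ctr, Finset.sum_apply, Pi.smul_apply]
    exact P.sum_mem fun a _ => P.smul_mem _ (hG _)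
  have pos : ∀ {k : ℕ} (G : (Fin k → Fin n) → V), (∀ ρ, G ρ ∈ P) → 0 ≤ CC h b G G := by
    intro k G hG
    rw [hB]; exact CC_nonneg B b P hP k G hG
  have hsg : (fun a c => h a c - u a * v c - v a * u c) = fun a c => s * g a c := by
    funext a c; simp only [hdef]; ring
  have hsym : ∀ a c, h a c = h c a := by
    intro a c; simp only [hdef, hg a c]; ring
  have k1 := key h b u v (m+1) F F hF hF
  have k2 := key h b u v m _ _ (hF.ctr u) (hF.ctr v)
  rw [hsg, CC_scale] at k1 k2
  have hm : (0:ℝ) < m + 1 := by positivity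
  have hX2 : 0 ≤ m * X2 h b u v (m+1) F F := by
    match m with
    | 0 => simp
    | m+1 => exact mul_nonneg (by positivity) (pos _ (hctr _ _ (hctr _ _ hFP)))
  have hX1 : (m:ℝ) * X1 h b u v m (ctr u F) (ctr v F) = - (m * X2 h b u v (m+1) F F) := by
    match m with
    | 0 => simp
    | m+1 => 
      simp only [X1, X2, hF.ctr_self, CC_zero_left, hF.ctr_ctr u v, CC_neg_right]; ring
  have hX22 : (m:ℝ) * (m - 1) * X2 h b u v m (ctr u F) (ctr v F) = 0 := by
    match m with
    | 0 => simp
    | 1 => simp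
    | m+2 => 
      simp only [X2, hF.ctr_self]
      have z : ctr v (0 : (Fin (m+1) → Fin n) → V) = 0 := by
        have := ctr_neg v (0 : (Fin (m+1) → Fin n) → V)
        rw [neg_zero] at this
        exact eq_zero_of_eq_neg this
      simp [z, CC_zero_left]
  have hX11 : X1 h b u v (m+1) F F = 2 * CC h b (ctr u F) (ctr v F) := by
    simp only [X1]
    rw [CC_symm h hsym b hb (ctr v F)]; ring
  rw [hX22, hX1] at k2
  rw [hX11] at k1
  have hp := pos F hFP
  have hsm : 0 < s ^ m := pow_pos hs m
  have : s ^ m * (CC g b (ctr u F) (ctr v F) + s / (2 * (m + 1 : ℝ)) * CC g b F F) =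
      CC h b F F / (2 * (m+1)) + (m * X2 h b u v (m+1) F F) / 2 := by
    have : s ^ m * (CC g b (ctr u F) (ctr v F) + s / (2 * (m + 1 : ℝ)) * CC g b F F) =
      s ^ m * CC g b (ctr u F) (ctr v F) + (s ^ (m+1) * CC g b F F) / (2 * (m+1)) := by
      rw [pow_succ]; field_simp
    rw [this, k1, k2]
    push_cast
    field_simp
    ring
  refine nonneg_of_mul_nonneg_right (a := s^m) ?_ hsm
  rw [this]
  positivity

end gen

section mink

lemma gmet_symm (n : ℕ) (a c : Fin n) : gmet n a c = gmet n c a := by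
  unfold gmet
  by_cases h : a = c
  · subst h; rfl
  · rw [if_neg h, if_neg (Ne.symm h)]

lemma gmet_sum (N : ℕ) (f g : Fin (N+1) → ℝ) :
    ∑ a, ∑ c, gmet (N+1) a c * f a * g c = - (f 0 * g 0) + ∑ i : Fin N, f i.succ * g i.succ := by
  have : ∀ a, ∑ c, gmet (N+1) a c * f a * g c = (if (a : ℕ) = 0 then -1 else 1) * f a * g a := by
    intro a
    simp [gmet, ite_mul]
  simp only [this, Fin.sum_univ_succ]
  simp

lemma real_ineq (u0 v0 x0 P Q R a b c : ℝ) (hu : 0 < u0) (hv : 0 < v0)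
    (hP : P < u0 ^ 2) (hQ : Q ≤ v0 ^ 2) (P0 : 0 ≤ P) (Q0 : 0 ≤ Q) (R0 : 0 ≤ R)
    (ha : a ^ 2 ≤ P * R) (hb : b ^ 2 ≤ Q * R) (hc : c ^ 2 ≤ P * Q)
    (gram : 0 ≤ P * Q * R + 2 * a * b * c - P * b ^ 2 - Q * a ^ 2 - R * c ^ 2) :
    0 < u0 * v0 - c ∧
    0 ≤ (u0 * v0 - c) * (R - x0 ^ 2) + 2 * (u0 * x0 + a) * (v0 * x0 + b) := by
  have hc2 : c ^ 2 < (u0 * v0) ^ 2 := by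
    have : 0 < v0 ^ 2 := by positivity
    nlinarith [mul_nonneg P0 (sub_nonneg.2 hQ), mul_pos (sub_pos.2 hP) this]
  have hab := abs_lt_of_sq_lt_sq hc2 (by positivity)
  rw [abs_lt] at hab
  refine ⟨by linarith [hab.2], ?_⟩
  have hA : 0 < u0 * v0 + c := by linarith [hab.1]
  have disc : 0 ≤ u0 ^ 2 * v0 ^ 2 * R + 2 * a * b * c - u0 ^ 2 * b ^ 2 - v0 ^ 2 * a ^ 2
      - R * c ^ 2 := by
    have e1 : 0 ≤ (u0 ^ 2 - P) * (v0 ^ 2 * R - b ^ 2) := by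
      apply mul_nonneg (by linarith)
      nlinarith
    have e2 : 0 ≤ (v0 ^ 2 - Q) * (P * R - a ^ 2) := by
      apply mul_nonneg (by linarith) (by linarith)
    nlinarith
  refine nonneg_of_mul_nonneg_right (a := u0 * v0 + c) ?_ hA
  have : (u0 * v0 + c) * ((u0 * v0 - c) * (R - x0 ^ 2) + 2 * (u0 * x0 + a) * (v0 * x0 + b))
    = ((u0 * v0 + c) * x0 + (u0 * b + v0 * a)) ^ 2 +
      (u0 ^ 2 * v0 ^ 2 * R + 2 * a * b * c - u0 ^ 2 * b ^ 2 - v0 ^ 2 * a ^ 2 - R * c ^ 2) := by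
    ring
  rw [this]
  positivity

lemma gram_nonneg {N : ℕ} (U W X : Fin N → ℝ) :
    0 ≤ (∑ i, U i ^ 2) * (∑ i, W i ^ 2) * (∑ i, X i ^ 2)
      + 2 * (∑ i, U i * X i) * (∑ i, W i * X i) * (∑ i, U i * W i)
      - (∑ i, U i ^ 2) * (∑ i, W i * X i) ^ 2 - (∑ i, W i ^ 2) * (∑ i, U i * X i) ^ 2
      - (∑ i, X i ^ 2) * (∑ i, U i * W i) ^ 2 := by
  set P := ∑ i, U i ^ 2 with hP
  set Q := ∑ i, W i ^ 2 with hQ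
  set R := ∑ i, X i ^ 2 with hR
  set a := ∑ i, U i * X i with ha
  set b := ∑ i, W i * X i with hb
  set c := ∑ i, U i * W i with hc
  have R0 : 0 ≤ R := Finset.sum_nonneg fun i _ => sq_nonneg _
  rcases R0.eq_or_lt with h | h
  · have hX : ∀ i, X i = 0 := by
      intro i
      have := (Finset.sum_eq_zero_iff_of_nonneg (fun i _ => sq_nonneg (X i))).1 h.symm i
        (Finset.mem_univ i)
      simpa using this
    have : a = 0 := by simp [ha, hX]
    have h2 : b = 0 := by simp [hb, hX]
    rw [← h, this, h2]; simp
  · have cs := Finset.sum_mul_sq_le_sq_mul_sq Finset.univ (fun i => R * U i - a * X i)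
      (fun i => R * W i - b * X i)
    have e1 : ∑ i, (R * U i - a * X i) * (R * W i - b * X i) = R * (R * c - a * b) := by
      have : ∀ i, (R * U i - a * X i) * (R * W i - b * X i) =
        R ^ 2 * (U i * W i) - R * b * (U i * X i) - R * a * (W i * X i) + a * b * X i ^ 2 := by
        intro i; ring
      simp only [this, Finset.sum_add_distrib, Finset.sum_sub_distrib, ← Finset.mul_sum]
      rw [← ha, ← hb, ← hc, ← hR]; ring
    have e2 : ∑ i, (R * U i - a * X i) ^ 2 = R * (R * P - a ^ 2) := by
      have : ∀ i, (R * U i - a * X i) ^ 2 =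
        R ^ 2 * (U i ^ 2) - 2 * R * a * (U i * X i) + a ^ 2 * X i ^ 2 := by
        intro i; ring
      simp only [this, Finset.sum_add_distrib, Finset.sum_sub_distrib, ← Finset.mul_sum]
      rw [← ha, ← hP, ← hR]; ring
    have e3 : ∑ i, (R * W i - b * X i) ^ 2 = R * (R * Q - b ^ 2) := by
      have : ∀ i, (R * W i - b * X i) ^ 2 =
        R ^ 2 * (W i ^ 2) - 2 * R * b * (W i * X i) + b ^ 2 * X i ^ 2 := by
        intro i; ring
      simp only [this, Finset.sum_add_distrib, Finset.sum_sub_distrib, ← Finset.mul_sum]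
      rw [← hb, ← hQ, ← hR]; ring
    rw [e1, e2, e3] at cs
    refine nonneg_of_mul_nonneg_right (a := R ^ 3) ?_ (by positivity)
    nlinarith [cs]

lemma mink_pos {N : ℕ} (u v x : Fin (N+1) → ℝ) (hu : minkSq (N+1) u < 0) (hu0 : 0 < u 0)
    (hv : minkSq (N+1) v ≤ 0) (hv0 : 0 < v 0) :
    0 < - ∑ a, ∑ c, gmet (N+1) a c * u a * v c ∧
    0 ≤ ∑ a, ∑ c, ((- ∑ a, ∑ c, gmet (N+1) a c * u a * v c) * gmet (N+1) a c
      + u a * v c + v a * u c) * x a * x c := by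
  have hsum : ∀ s : ℝ, ∑ a, ∑ c, (s * gmet (N+1) a c + u a * v c + v a * u c) * x a * x c =
      s * (∑ a, ∑ c, gmet (N+1) a c * x a * x c) + 2 * (∑ a, u a * x a) * (∑ a, v a * x a) := by
    intro s
    have : 2 * (∑ a, u a * x a) * (∑ a, v a * x a) = (∑ a, u a * x a) * (∑ a, v a * x a)
      + (∑ a, v a * x a) * (∑ a, u a * x a) := by ring
    rw [this, Finset.sum_mul_sum, Finset.sum_mul_sum]
    simp only [Finset.mul_sum, ← Finset.sum_add_distrib]
    refine Finset.sum_congr rfl fun a _ => Finset.sum_congr rfl fun c _ => ?_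
    ring
  rw [hsum]
  unfold minkSq at hu hv
  rw [gmet_sum] at hu hv ⊢
  rw [gmet_sum]
  simp only [Fin.sum_univ_succ (n := N) (f := fun a => u a * x a),
    Fin.sum_univ_succ (n := N) (f := fun a => v a * x a)]
  have nn : ∀ f : Fin N → ℝ, 0 ≤ ∑ i, f i ^ 2 := fun f => Finset.sum_nonneg fun i _ => sq_nonneg _
  simp only [← pow_two] at hu hv ⊢
  have := real_ineq (u 0) (v 0) (x 0) _ _ _ _ _ _ hu0 hv0 (by linarith) (by linarith)
    (nn fun i => u i.succ) (nn fun i => v i.succ) (nn fun i => x i.succ)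
    (Finset.sum_mul_sq_le_sq_mul_sq Finset.univ _ _)
    (Finset.sum_mul_sq_le_sq_mul_sq Finset.univ _ _)
    (Finset.sum_mul_sq_le_sq_mul_sq Finset.univ _ _)
    (gram_nonneg (fun i => u i.succ) (fun i => v i.succ) (fun i => x i.succ))
  refine ⟨by linarith [this.1], ?_⟩
  convert this.2 using 2
  ring

variable {V : Type*} [AddCommGroup V] [Module ℝ V]

/-- Dominant property for vector-valued forms. -/
lemma Q_nonneg {N : ℕ} (u v : Fin (N+1) → ℝ) (hu : minkSq (N+1) u ≤ 0) (hu0 : 0 < u 0)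
    (hv : minkSq (N+1) v ≤ 0) (hv0 : 0 < v 0)
    (b : V →ₗ[ℝ] V →ₗ[ℝ] ℝ) (hb : ∀ x y, b x y = b y x)
    (P : Submodule ℝ V) (hP : ∀ x ∈ P, 0 ≤ b x x) (m : ℕ) (F : (Fin (m+1) → Fin (N+1)) → V)
    (hF : Anti F) (hFP : ∀ ρ, F ρ ∈ P) :
    0 ≤ CC (gmet (N+1)) b (ctr u F) (ctr v F) +
      (- ∑ a, ∑ c, gmet (N+1) a c * u a * v c) / (2 * (m + 1 : ℝ)) * CC (gmet (N+1)) b F F := by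
  have strict : ∀ w : Fin (N+1) → ℝ, minkSq (N+1) w < 0 → 0 < w 0 →
    0 ≤ CC (gmet (N+1)) b (ctr w F) (ctr v F) +
      (- ∑ a, ∑ c, gmet (N+1) a c * w a * v c) / (2 * (m + 1 : ℝ)) * CC (gmet (N+1)) b F F := by
    intro w hw hw0
    exact Q_nonneg_of (gmet (N+1)) _ (mink_pos w v 0 hw hw0 hv hv0).1 w v (gmet_symm _)
      (fun x => (mink_pos w v x hw hw0 hv hv0).2) b hb P hP m F hF hFP
  set e : Fin (N+1) → ℝ := Pi.single 0 1 with he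
  have e0 : e 0 = 1 := by simp [he]
  have es : ∀ i : Fin N, e i.succ = 0 := fun i => by simp [he]
  have hctr : ∀ t : ℝ, ctr (u + t • e) F = ctr u F + t • ctr e F := by
    intro t
    simp [ctr, add_smul, Finset.sum_add_distrib, Finset.smul_sum, smul_smul]
  have hlim : ∀ t : ℝ, 0 < t → 0 ≤ (CC (gmet (N+1)) b (ctr u F) (ctr v F) +
      (- ∑ a, ∑ c, gmet (N+1) a c * u a * v c) / (2 * (m + 1 : ℝ)) * CC (gmet (N+1)) b F F) +
      t * (CC (gmet (N+1)) b (ctr e F) (ctr v F) +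
      (- ∑ a, ∑ c, gmet (N+1) a c * e a * v c) / (2 * (m + 1 : ℝ)) * CC (gmet (N+1)) b F F) := by
    intro t ht
    refine (strict (u + t • e) ?_ ?_).trans_eq ?_
    · unfold minkSq at hu ⊢
      rw [gmet_sum] at hu ⊢
      simp only [Pi.add_apply, Pi.smul_apply, e0, es, smul_eq_mul, mul_zero, add_zero]
      nlinarith [mul_pos ht hu0]
    · simp only [Pi.add_apply, Pi.smul_apply, e0, smul_eq_mul]; linarith
    · rw [hctr, CC_add_left, CC_smul_left]
      have : ∑ a, ∑ c, gmet (N+1) a c * (u + t • e) a * v c =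
        ∑ a, ∑ c, gmet (N+1) a c * u a * v c + t * ∑ a, ∑ c, gmet (N+1) a c * e a * v c := by
        simp only [Finset.mul_sum, ← Finset.sum_add_distrib]
        refine Finset.sum_congr rfl fun a _ => Finset.sum_congr rfl fun c _ => ?_
        simp only [Pi.add_apply, Pi.smul_apply, smul_eq_mul]; ring
      rw [this]; ring
  generalize (CC (gmet (N+1)) b (ctr e F) (ctr v F) +
      (- ∑ a, ∑ c, gmet (N+1) a c * e a * v c) / (2 * (m + 1 : ℝ)) * CC (gmet (N+1)) b F F) = y
      at hlim
  refine ge_of_tendsto (f := fun t : ℝ => _ + t * y) (x := nhdsWithin 0 (Set.Ioi 0)) ?_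
    (Filter.eventually_of_mem self_mem_nhdsWithin fun t ht => hlim t ht)
  have hc : Continuous fun t : ℝ => (CC (gmet (N+1)) b (ctr u F) (ctr v F) +
      (- ∑ a, ∑ c, gmet (N+1) a c * u a * v c) / (2 * (m + 1 : ℝ)) * CC (gmet (N+1)) b F F) +
      t * y := by fun_prop
  have := hc.tendsto 0
  simp only [zero_mul, add_zero] at this
  exact this.mono_left nhdsWithin_le_nhds

end mink

section fin

def mulB : ℝ →ₗ[ℝ] ℝ →ₗ[ℝ] ℝ := LinearMap.mul ℝ ℝ

lemma mulB_apply (x y : ℝ) : mulB x y = x * y := rfl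

def ctrL {n r : ℕ} (w : Fin n → ℝ) :
    ((Fin (r+1) → Fin n) → ℝ) →ₗ[ℝ] ((Fin r → Fin n) → ℝ) :=
  ∑ a, w a • LinearMap.funLeft ℝ ℝ (fun ρ => (Fin.cons a ρ : Fin (r+1) → Fin n))

lemma ctrL_apply {n r : ℕ} (w : Fin n → ℝ) (X : (Fin (r+1) → Fin n) → ℝ) :
    ctrL w X = ctr w X := by
  funext ρ
  simp [ctrL, ctr, sl, LinearMap.funLeft_apply]

/-- Bilinear contraction with one free index contracted with `w` and `z`. -/
def B11 {n : ℕ} (r : ℕ) (w z : Fin n → ℝ) :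
    ((Fin (r+1) → Fin n) → ℝ) →ₗ[ℝ] ((Fin (r+1) → Fin n) → ℝ) →ₗ[ℝ] ℝ :=
  (CCb (gmet n) mulB r).compl₁₂ (ctrL w) (ctrL z)

lemma B11_apply {n : ℕ} (r : ℕ) (w z : Fin n → ℝ) (X Y : (Fin (r+1) → Fin n) → ℝ) :
    B11 r w z X Y = CC (gmet n) mulB (ctr w X) (ctr z Y) := by
  simp [B11, CC_eq, ctrL_apply]

def B00 {n : ℕ} (r : ℕ) :
    ((Fin (r+1) → Fin n) → ℝ) →ₗ[ℝ] ((Fin (r+1) → Fin n) → ℝ) →ₗ[ℝ] ℝ :=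
  CCb (gmet n) mulB (r+1)

lemma CC_lin {n : ℕ} {V : Type*} [AddCommGroup V] [Module ℝ V] (g : Fin n → Fin n → ℝ)
    (b b' b'' : V →ₗ[ℝ] V →ₗ[ℝ] ℝ) (x y z : ℝ) {p : ℕ} (F G : (Fin p → Fin n) → V) :
    CC g (x • b + y • b' + z • b'') F G = x * CC g b F G + y * CC g b' F G + z * CC g b'' F G := by
  simp only [CC, Finset.mul_sum, ← Finset.sum_add_distrib, LinearMap.add_apply,
    LinearMap.smul_apply, smul_eq_mul]
  refine Finset.sum_congr rfl fun a _ => Finset.sum_congr rfl fun c _ => ?_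
  ring

lemma prod_ne_zero {m : ℕ} (hp : 0 < m + 1) (f : Fin (m+1) → ℝ) :
    ∏ i ∈ Finset.univ.filter (fun i => i ≠ (⟨0, hp⟩ : Fin (m+1))), f i = ∏ i : Fin m, f i.succ := by
  rw [Finset.prod_filter, Fin.prod_univ_succ]
  simp

/-- pulling one pair of free indices. -/
lemma sum_free {n m : ℕ} (hp : 0 < m + 1) (α β : Fin n)
    (f : (Fin (m+1) → Fin n) → (Fin (m+1) → Fin n) → ℝ) :
    (∑ ρ : Fin (m+1) → Fin n, ∑ ρ' : Fin (m+1) → Fin n,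
      if ρ ⟨0, hp⟩ = α ∧ ρ' ⟨0, hp⟩ = β then f ρ ρ' else 0) =
    ∑ ρ : Fin m → Fin n, ∑ ρ' : Fin m → Fin n, f (Fin.cons α ρ) (Fin.cons β ρ') := by
  have h0 : (⟨0, hp⟩ : Fin (m+1)) = 0 := rfl
  rw [sum_tuple]
  simp_rw [sum_tuple (p := m), h0, Fin.cons_zero]
  rw [Finset.sum_eq_single α]
  · refine Finset.sum_congr rfl fun ρ _ => ?_
    rw [Finset.sum_eq_single β]
    · simp
    · intro c _ hc; simp [hc]
    · simp
  · intro c _ hc; simp [hc]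
  · simp

lemma sum4 {A A' B B' : Type*} [Fintype A] [Fintype A'] [Fintype B] [Fintype B']
    (f : A → A' → B → B' → ℝ) :
    ∑ a, ∑ a', ∑ b, ∑ b', f a a' b b' = ∑ b, ∑ b', ∑ a, ∑ a', f a a' b b' := by
  have h1 : ∑ a, ∑ a', ∑ b, ∑ b', f a a' b b' =
      ∑ x : A × A', ∑ y : B × B', f x.1 x.2 y.1 y.2 := by simp [Fintype.sum_prod_type]
  have h2 : ∑ b, ∑ b', ∑ a, ∑ a', f a a' b b' =
      ∑ y : B × B', ∑ x : A × A', f x.1 x.2 y.1 y.2 := by simp [Fintype.sum_prod_type]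
  rw [h1, h2, Finset.sum_comm]

lemma prod4 {n : ℕ} (f h : Fin n → Fin n → ℝ) :
    (∑ a, ∑ b, f a b) * (∑ c, ∑ d, h c d) = ∑ a, ∑ b, ∑ c, ∑ d, f a b * h c d := by
  simp only [Finset.sum_mul, Finset.mul_sum]
  rw [sum4]

lemma dCon00_eq (n m r : ℕ) (K : (Fin (m+1) → Fin n) → (Fin (r+1) → Fin n) → ℝ) :
    dCon00 n (m+1) (r+1) K = CC (gmet n) (B00 r) K K := by
  unfold dCon00 CC B00
  simp only [← CC_eq, CC, mulB_apply, Finset.mul_sum]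
  refine Finset.sum_congr rfl fun ρ _ => Finset.sum_congr rfl fun ρ' _ =>
    Finset.sum_congr rfl fun σ _ => Finset.sum_congr rfl fun σ' _ => ?_
  ring

lemma dCon10_eq (n m r : ℕ) (hp : 0 < m + 1)
    (K : (Fin (m+1) → Fin n) → (Fin (r+1) → Fin n) → ℝ) (α β : Fin n) :
    dCon10 n (m+1) (r+1) hp K α β = CC (gmet n) (B00 r) (sl α K) (sl β K) := by
  have : dCon10 n (m+1) (r+1) hp K α β = ∑ ρ : Fin (m+1) → Fin n, ∑ ρ' : Fin (m+1) → Fin n,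
      if ρ ⟨0, hp⟩ = α ∧ ρ' ⟨0, hp⟩ = β then
      ∑ σ : Fin (r+1) → Fin n, ∑ σ' : Fin (r+1) → Fin n, K ρ σ * K ρ' σ' *
        (∏ i ∈ Finset.univ.filter (fun i => i ≠ (⟨0, hp⟩ : Fin (m+1))), gmet n (ρ i) (ρ' i)) *
        (∏ j : Fin (r+1), gmet n (σ j) (σ' j)) else 0 := by
    unfold dCon10
    refine Finset.sum_congr rfl fun ρ _ => Finset.sum_congr rfl fun ρ' _ => ?_
    split_ifs <;> simp
  rw [this, sum_free]
  simp only [prod_ne_zero, Fin.cons_succ]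
  unfold CC B00
  simp only [← CC_eq, CC, mulB_apply, Finset.mul_sum, sl]
  refine Finset.sum_congr rfl fun ρ _ => Finset.sum_congr rfl fun ρ' _ =>
    Finset.sum_congr rfl fun σ _ => Finset.sum_congr rfl fun σ' _ => ?_
  ring

lemma dCon01_eq (n m r : ℕ) (hq : 0 < r + 1)
    (K : (Fin (m+1) → Fin n) → (Fin (r+1) → Fin n) → ℝ) (lam mu : Fin n) :
    dCon01 n (m+1) (r+1) hq K lam mu = ∑ ρ, ∑ ρ', (∏ i, gmet n (ρ i) (ρ' i)) *
      CC (gmet n) mulB (sl lam (K ρ)) (sl mu (K ρ')) := by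
  unfold dCon01
  refine Finset.sum_congr rfl fun ρ _ => Finset.sum_congr rfl fun ρ' _ => ?_
  rw [sum_free]
  simp only [prod_ne_zero, Fin.cons_succ]
  simp only [CC, mulB_apply, Finset.mul_sum, sl]
  refine Finset.sum_congr rfl fun σ _ => Finset.sum_congr rfl fun σ' _ => ?_
  ring

lemma dCon11_eq (n m r : ℕ) (hp : 0 < m + 1) (hq : 0 < r + 1)
    (K : (Fin (m+1) → Fin n) → (Fin (r+1) → Fin n) → ℝ) (α β lam mu : Fin n) :
    dCon11 n (m+1) (r+1) hp hq K α β lam mu = ∑ ρ, ∑ ρ', (∏ i, gmet n (ρ i) (ρ' i)) *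
      CC (gmet n) mulB (sl lam (sl α K ρ)) (sl mu (sl β K ρ')) := by
  have : dCon11 n (m+1) (r+1) hp hq K α β lam mu =
      ∑ ρ : Fin (m+1) → Fin n, ∑ ρ' : Fin (m+1) → Fin n,
      if ρ ⟨0, hp⟩ = α ∧ ρ' ⟨0, hp⟩ = β then
      ∑ σ : Fin (r+1) → Fin n, ∑ σ' : Fin (r+1) → Fin n,
        if σ ⟨0, hq⟩ = lam ∧ σ' ⟨0, hq⟩ = mu then K ρ σ * K ρ' σ' *
        (∏ i ∈ Finset.univ.filter (fun i => i ≠ (⟨0, hp⟩ : Fin (m+1))), gmet n (ρ i) (ρ' i)) *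
        (∏ j ∈ Finset.univ.filter (fun j => j ≠ (⟨0, hq⟩ : Fin (r+1))), gmet n (σ j) (σ' j))
        else 0 else 0 := by
    unfold dCon11
    refine Finset.sum_congr rfl fun ρ _ => Finset.sum_congr rfl fun ρ' _ => ?_
    split_ifs with h
    · simp only [h, true_and]
    · refine Finset.sum_eq_zero fun σ _ => Finset.sum_eq_zero fun σ' _ => if_neg ?_
      tauto
  rw [this, sum_free]
  refine Finset.sum_congr rfl fun ρ _ => Finset.sum_congr rfl fun ρ' _ => ?_
  rw [sum_free]
  simp only [prod_ne_zero, Fin.cons_succ]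
  simp only [CC, mulB_apply, Finset.mul_sum, sl]
  refine Finset.sum_congr rfl fun σ _ => Finset.sum_congr rfl fun σ' _ => ?_
  ring

lemma CC_B11 {n r p : ℕ} (w z : Fin n → ℝ) (F G : (Fin p → Fin n) → (Fin (r+1) → Fin n) → ℝ) :
    CC (gmet n) (B11 r w z) F G = ∑ lam, ∑ mu, (∑ ρ, ∑ ρ', (∏ i, gmet n (ρ i) (ρ' i)) *
      CC (gmet n) mulB (sl lam (F ρ)) (sl mu (G ρ'))) * w lam * z mu := by
  rw [CC]
  simp only [B11_apply, CC_ctr, Finset.mul_sum]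
  rw [sum4]
  simp only [Finset.sum_mul]
  refine Finset.sum_congr rfl fun ρ _ => Finset.sum_congr rfl fun ρ' _ =>
    Finset.sum_congr rfl fun σ _ => Finset.sum_congr rfl fun σ' _ => ?_
  ring

lemma S01 (n m r : ℕ) (hq : 0 < r + 1) (w z : Fin n → ℝ)
    (K : (Fin (m+1) → Fin n) → (Fin (r+1) → Fin n) → ℝ) :
    ∑ lam, ∑ mu, dCon01 n (m+1) (r+1) hq K lam mu * w lam * z mu =
      CC (gmet n) (B11 r w z) K K := by
  rw [CC_B11]; simp only [dCon01_eq]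

lemma S10 (n m r : ℕ) (hp : 0 < m + 1) (u v : Fin n → ℝ)
    (K : (Fin (m+1) → Fin n) → (Fin (r+1) → Fin n) → ℝ) :
    ∑ α, ∑ β, dCon10 n (m+1) (r+1) hp K α β * u α * v β =
      CC (gmet n) (B00 r) (ctr u K) (ctr v K) := by
  rw [CC_ctr]; simp only [dCon10_eq]
  refine Finset.sum_congr rfl fun σ _ => Finset.sum_congr rfl fun σ' _ => ?_
  ring

lemma S11 (n m r : ℕ) (hp : 0 < m + 1) (hq : 0 < r + 1) (u v w z : Fin n → ℝ)
    (K : (Fin (m+1) → Fin n) → (Fin (r+1) → Fin n) → ℝ) :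
    ∑ α, ∑ β, ∑ lam, ∑ mu, dCon11 n (m+1) (r+1) hp hq K α β lam mu * u α * v β * w lam * z mu =
      CC (gmet n) (B11 r w z) (ctr u K) (ctr v K) := by
  rw [CC_ctr]; simp only [dCon11_eq, CC_B11]
  refine Finset.sum_congr rfl fun α _ => Finset.sum_congr rfl fun β _ => ?_
  rw [Finset.mul_sum]
  refine Finset.sum_congr rfl fun σ _ => ?_
  rw [Finset.mul_sum]
  refine Finset.sum_congr rfl fun σ' _ => ?_
  ring

lemma mulB_symm (x y : ℝ) : mulB x y = mulB y x := mul_comm x y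

lemma B11_symm {n : ℕ} (r : ℕ) (w z : Fin n → ℝ) (X Y : (Fin (r+1) → Fin n) → ℝ) :
    B11 r w z X Y = B11 r z w Y X := by
  rw [B11_apply, B11_apply, CC_symm _ (gmet_symm n) _ mulB_symm]

lemma B00_symm {n : ℕ} (r : ℕ) (X Y : (Fin (r+1) → Fin n) → ℝ) :
    B00 r X Y = B00 r Y X := CC_symm _ (gmet_symm n) _ mulB_symm X Y

lemma CC_B11_symm {n r p : ℕ} (w z : Fin n → ℝ)
    (F : (Fin p → Fin n) → (Fin (r+1) → Fin n) → ℝ) :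
    CC (gmet n) (B11 r w z) F F = CC (gmet n) (B11 r z w) F F := by
  unfold CC
  rw [Finset.sum_comm]
  refine Finset.sum_congr rfl fun a _ => Finset.sum_congr rfl fun c _ => ?_
  rw [B11_symm]; congr 1
  exact Finset.prod_congr rfl fun i _ => gmet_symm _ _ _

def AntiSub (n q : ℕ) : Submodule ℝ ((Fin q → Fin n) → ℝ) where
  carrier := {X | Anti X}
  add_mem' := by
    intro a b ha hb π ρ
    simp only [Pi.add_apply, smul_add, ← ha π ρ, ← hb π ρ]
  zero_mem' := by intro π ρ; simp
  smul_mem' := by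
    intro c x hx π ρ
    simp only [Pi.smul_apply]
    rw [hx π ρ, smul_comm]

lemma seTK_sum (n m r : ℕ) (hp : 0 < m + 1) (hq : 0 < r + 1) (u v w z : Fin n → ℝ)
    (K : (Fin (m+1) → Fin n) → (Fin (r+1) → Fin n) → ℝ) :
    ∑ α, ∑ β, ∑ lam, ∑ mu, seTK n (m+1) (r+1) hp hq K α β lam mu * u α * v β * w lam * z mu =
    (1 / (((m + 1 - 1).factorial : ℝ) * ((r + 1 - 1).factorial : ℝ))) *
    (CC (gmet n) (B11 r w z) (ctr u K) (ctr v K) + CC (gmet n) (B11 r z w) (ctr u K) (ctr v K)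
      - (1 / ((m + 1 : ℕ) : ℝ)) * ((∑ a, ∑ c, gmet n a c * u a * v c) *
          CC (gmet n) (B11 r w z) K K)
      - (1 / ((r + 1 : ℕ) : ℝ)) * (CC (gmet n) (B00 r) (ctr u K) (ctr v K) *
          (∑ a, ∑ c, gmet n a c * w a * z c))
      + (1 / (2 * ((m + 1 : ℕ) : ℝ) * ((r + 1 : ℕ) : ℝ))) * dCon00 n (m+1) (r+1) K *
        ((∑ a, ∑ c, gmet n a c * u a * v c) * (∑ a, ∑ c, gmet n a c * w a * z c))) := by
  have h' : CC (gmet n) (B11 r z w) (ctr u K) (ctr v K) = ∑ α, ∑ β, ∑ lam, ∑ mu,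
      dCon11 n (m+1) (r+1) hp hq K α β mu lam * u α * v β * z mu * w lam := by
    rw [← S11 n m r hp hq]
    refine Finset.sum_congr rfl fun α _ => Finset.sum_congr rfl fun β _ => ?_
    rw [Finset.sum_comm]
  rw [h', ← S11 n m r hp hq, ← S01 n m r hq, ← S10 n m r hp, prod4, prod4, prod4]
  simp only [Finset.mul_sum, ← Finset.sum_add_distrib, ← Finset.sum_sub_distrib]
  refine Finset.sum_congr rfl fun ρ _ => Finset.sum_congr rfl fun ρ' _ =>
    Finset.sum_congr rfl fun σ _ => Finset.sum_congr rfl fun σ' _ => ?_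
  unfold seTK
  ring

end fin

/-- the dominant super-energy property for double `(p,q)`-forms. -/
theorem dominant_superenergy_doubleform
    (n p q : ℕ) (hp : 1 ≤ p) (hpn : p ≤ n) (hq : 1 ≤ q) (hqn : q ≤ n)
    (K : (Fin p → Fin n) → (Fin q → Fin n) → ℝ) (hK : IsDoubleForm n p q K)
    (k₁ k₂ k₃ k₄ : Fin n → ℝ)
    (h₁c : minkSq n k₁ ≤ 0) (h₁f : 0 < k₁ ⟨0, by omega⟩)
    (h₂c : minkSq n k₂ ≤ 0) (h₂f : 0 < k₂ ⟨0, by omega⟩)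
    (h₃c : minkSq n k₃ ≤ 0) (h₃f : 0 < k₃ ⟨0, by omega⟩)
    (h₄c : minkSq n k₄ ≤ 0) (h₄f : 0 < k₄ ⟨0, by omega⟩) :
    0 ≤ ∑ α : Fin n, ∑ β : Fin n, ∑ lam : Fin n, ∑ mu : Fin n,
          seTK n p q hp hq K α β lam mu * k₁ α * k₂ β * k₃ lam * k₄ mu := by
  obtain ⟨m, rfl⟩ : ∃ m, p = m + 1 := ⟨p - 1, by omega⟩
  obtain ⟨r, rfl⟩ : ∃ r, q = r + 1 := ⟨q - 1, by omega⟩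
  obtain ⟨N, rfl⟩ : ∃ N, n = N + 1 := ⟨n - 1, by omega⟩
  rw [seTK_sum]
  refine mul_nonneg (by positivity) ?_
  have hq0 : (0:ℝ) < r + 1 := by positivity
  have hp0 : (0:ℝ) < m + 1 := by positivity
  set s' : ℝ := - ∑ a, ∑ c, gmet (N+1) a c * k₃ a * k₄ c with hs'
  have hs2 : ∑ a, ∑ c, gmet (N+1) a c * k₃ a * k₄ c = - s' := by rw [hs', neg_neg]
  have main := Q_nonneg k₁ k₂ h₁c h₁f h₂c h₂f
    ((1/2 : ℝ) • B11 r k₃ k₄ + (1/2 : ℝ) • B11 r k₄ k₃ + (s' / (2 * (r + 1 : ℝ))) • B00 r)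
    (by
      intro x y
      simp only [LinearMap.add_apply, LinearMap.smul_apply, smul_eq_mul]
      rw [B11_symm r k₃ k₄ x y, B11_symm r k₄ k₃ x y, B00_symm r x y]; ring)
    (AntiSub (N+1) (r+1))
    (by
      intro x hx
      simp only [LinearMap.add_apply, LinearMap.smul_apply, smul_eq_mul]
      rw [B11_symm r k₄ k₃ x x]
      have := Q_nonneg k₃ k₄ h₃c h₃f h₄c h₄f mulB mulB_symm ⊤
        (fun y _ => mul_self_nonneg y) r x hx (fun _ => trivial)
      rw [← B11_apply] at this
      refine this.trans_eq ?_
      change _ = _ + _ * CC (gmet (N+1)) mulB x x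
      ring)
    m K
    (by
      intro π ρ
      funext σ
      exact hK.1 π ρ σ)
    (by
      intro ρ π σ
      exact hK.2 π ρ σ)
  rw [CC_lin, CC_lin, CC_B11_symm k₄ k₃ K, ← dCon00_eq] at main
  rw [hs2]
  refine (mul_nonneg zero_le_two main).trans_eq ?_
  push_cast
  field_simp
  ring
end
end

section
/- Let 1 ≤ p ≤ n and 1 ≤ q ≤ n. If K is a nonzero double (p,q)-form on n-dimensional Minkowski space and w₁, w₂, w₃, w₄ are future-pointing timelike vectors, then T{K}_{αβλμ} w₁^α w₂^β w₃^λ w₄^μ > 0. -/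
open Finset

noncomputable section

namespace SEProof

/-- signs of the metric -/
def sg (n : ℕ) (μ : Fin n) : ℝ := if (μ : ℕ) = 0 then -1 else 1

/-- Minkowski product -/
def mk (n : ℕ) (u v : Fin n → ℝ) : ℝ := ∑ μ, sg n μ * u μ * v μ

lemma gmet_eq (n : ℕ) (μ ν : Fin n) : gmet n μ ν = if μ = ν then sg n μ else 0 := rfl

lemma sg_sq (n : ℕ) (μ : Fin n) : sg n μ * sg n μ = 1 := by
  unfold sg; split_ifs <;> norm_num

lemma mk_add_left (n : ℕ) (u v w : Fin n → ℝ) : mk n (u + v) w = mk n u w + mk n v w := by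
  simp only [mk, ← Finset.sum_add_distrib, Pi.add_apply]
  exact Finset.sum_congr rfl fun _ _ => by ring

lemma mk_smul_left (n : ℕ) (c : ℝ) (v w : Fin n → ℝ) : mk n (c • v) w = c * mk n v w := by
  simp only [mk, Finset.mul_sum, Pi.smul_apply, smul_eq_mul]
  exact Finset.sum_congr rfl fun _ _ => by ring

lemma mk_comm (n : ℕ) (v w : Fin n → ℝ) : mk n v w = mk n w v := by
  simp only [mk]
  exact Finset.sum_congr rfl fun _ _ => by ring

lemma mk_sub_left (n : ℕ) (u v w : Fin n → ℝ) : mk n (u - v) w = mk n u w - mk n v w := by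
  simp only [mk, ← Finset.sum_sub_distrib, Pi.sub_apply]
  exact Finset.sum_congr rfl fun _ _ => by ring

lemma mk_add_right (n : ℕ) (u v w : Fin n → ℝ) : mk n w (u + v) = mk n w u + mk n w v := by
  rw [mk_comm, mk_add_left, mk_comm n u, mk_comm n v]

lemma mk_sub_right (n : ℕ) (u v w : Fin n → ℝ) : mk n w (u - v) = mk n w u - mk n w v := by
  rw [mk_comm, mk_sub_left, mk_comm n u, mk_comm n v]

lemma mk_smul_right (n : ℕ) (c : ℝ) (v w : Fin n → ℝ) : mk n w (c • v) = c * mk n w v := by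
  rw [mk_comm, mk_smul_left, mk_comm n v]

lemma minkSq_eq (n : ℕ) (v : Fin n → ℝ) : minkSq n v = mk n v v := by
  simp [minkSq, mk, gmet_eq, Finset.sum_ite_eq]

lemma mk_single (n : ℕ) (v : Fin n → ℝ) (μ : Fin n) :
    mk n v (Pi.single μ 1) = sg n μ * v μ := by
  simp [mk, Pi.single_apply]

lemma mk_self_nonneg (n : ℕ) (hn : 0 < n) (x : Fin n → ℝ) (h : x ⟨0, hn⟩ = 0) :
    mk n x x = ∑ μ, x μ ^ 2 := by
  unfold mk
  refine Finset.sum_congr rfl fun μ _ => ?_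
  unfold sg
  split_ifs with h0
  · have : μ = ⟨0, hn⟩ := Fin.ext h0
    rw [this, h]; ring
  · ring

/-- reverse Cauchy-Schwarz sign -/
lemma mk_neg (n : ℕ) (hn : 0 < n) (u v : Fin n → ℝ) (hu : mk n u u < 0) (hv : mk n v v < 0)
    (hu0 : 0 < u ⟨0, hn⟩) (hv0 : 0 < v ⟨0, hn⟩) : mk n u v < 0 := by
  have h := mk_self_nonneg n hn (v ⟨0, hn⟩ • u - u ⟨0, hn⟩ • v) (by simp; ring)
  have h2 : 0 ≤ mk n (v ⟨0, hn⟩ • u - u ⟨0, hn⟩ • v) (v ⟨0, hn⟩ • u - u ⟨0, hn⟩ • v) := by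
    rw [h]; positivity
  simp only [mk_sub_left, mk_sub_right, mk_smul_left, mk_smul_right, mk_comm n v u] at h2
  by_contra hc
  push Not at hc
  have h3 : v ⟨0, hn⟩ * (v ⟨0, hn⟩ * mk n u u) < 0 := by
    have := mul_pos hv0 hv0
    nlinarith
  have h4 : u ⟨0, hn⟩ * (u ⟨0, hn⟩ * mk n v v) < 0 := by
    have := mul_pos hu0 hu0
    nlinarith
  have h5 : 0 ≤ v ⟨0, hn⟩ * (u ⟨0, hn⟩ * mk n u v) := by positivity
  nlinarith

/-- Householder reflection -/
lemma householder (n : ℕ) (a b : Fin n → ℝ) (hab : mk n a a = mk n b b)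
    (hd : mk n (a - b) (a - b) ≠ 0) :
    ∃ L : (Fin n → ℝ) →ₗ[ℝ] (Fin n → ℝ), (∀ x y, mk n (L x) (L y) = mk n x y) ∧ L a = b ∧
      ∀ c, mk n (a - b) c = 0 → L c = c := by
  have hda : 2 * mk n (a - b) a = mk n (a - b) (a - b) := by
    simp only [mk_sub_left, mk_sub_right, mk_comm n b a]; linarith
  let L : (Fin n → ℝ) →ₗ[ℝ] (Fin n → ℝ) :=
    { toFun := fun x => x - (2 * mk n (a - b) x / mk n (a - b) (a - b)) • (a - b)
      map_add' := by
        intro x y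
        rw [mk_add_right]
        ext i; simp; ring
      map_smul' := by
        intro c x
        rw [mk_smul_right]
        ext i; simp; ring }
  have hL : ∀ x, L x = x - (2 * mk n (a - b) x / mk n (a - b) (a - b)) • (a - b) := fun _ => rfl
  refine ⟨L, ?_, ?_, ?_⟩
  · intro x y
    rw [hL, hL]
    generalize hD : a - b = d at *
    rw [mk_sub_left, mk_sub_right, mk_sub_right, mk_smul_left, mk_smul_left, mk_smul_right,
      mk_smul_right, mk_comm n x d]
    field_simp
    ring
  · rw [hL, hda, div_self hd]; simp
  · intro c hc
    rw [hL, hc]; simp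

/-- normal form of a spatial vector -/
lemma spatial_normal (n : ℕ) (hn : 0 < n) (x : Fin n → ℝ) (hx : x ⟨0, hn⟩ = 0) :
    ∃ L : (Fin n → ℝ) →ₗ[ℝ] (Fin n → ℝ), (∀ x y, mk n (L x) (L y) = mk n x y) ∧
      L (Pi.single ⟨0, hn⟩ 1) = Pi.single ⟨0, hn⟩ 1 ∧ (L x) ⟨0, hn⟩ = 0 ∧
      ∀ a b, a ≠ b → L x a * L x b = 0 := by
  by_cases h0 : x = 0
  · subst h0
    exact ⟨LinearMap.id, fun _ _ => rfl, rfl, rfl, fun _ _ _ => by simp⟩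
  obtain ⟨j, hj⟩ : ∃ j, x j ≠ 0 := by
    by_contra hc; push Not at hc; exact h0 (funext hc)
  have hj0 : j ≠ ⟨0, hn⟩ := by rintro rfl; exact hj hx
  have hsgj : sg n j = 1 := by
    unfold sg; rw [if_neg]; intro h; exact hj0 (Fin.ext h)
  set r := Real.sqrt (mk n x x) with hr
  have hxx : 0 ≤ mk n x x := by rw [mk_self_nonneg n hn x hx]; positivity
  have hr2 : r * r = mk n x x := Real.mul_self_sqrt hxx
  set b : Fin n → ℝ := r • Pi.single j 1 with hb
  have hb0 : b ⟨0, hn⟩ = 0 := by simp [hb, hj0.symm]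
  have hbb : mk n b b = r * r := by
    rw [hb, mk_smul_left, mk_smul_right, mk_single, hsgj]; simp
  have hbm : ∀ a c, a ≠ c → b a * b c = 0 := by
    intro a c hac
    simp only [hb, Pi.smul_apply, Pi.single_apply, smul_eq_mul]
    split_ifs with h1 h2
    · exact absurd (h1.trans h2.symm) hac
    all_goals simp
  by_cases hxb : x = b
  · exact ⟨LinearMap.id, fun _ _ => rfl, rfl, hx, fun a c hac => by
      rw [LinearMap.id_apply, hxb]; exact hbm a c hac⟩
  have hd : mk n (x - b) (x - b) ≠ 0 := by
    rw [mk_self_nonneg n hn (x - b) (by simp [hx, hb0])]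
    intro hc
    rw [Finset.sum_eq_zero_iff_of_nonneg (fun _ _ => sq_nonneg _)] at hc
    apply hxb
    funext i
    have := hc i (Finset.mem_univ _)
    have := pow_eq_zero_iff (two_ne_zero) |>.1 this
    simp at this; linarith
  obtain ⟨L, h1, h2, h3⟩ := householder n x b (by rw [hbb, hr2]) hd
  refine ⟨L, h1, h3 _ ?_, by rw [h2, hb0], by rw [h2]; exact hbm⟩
  rw [mk_single]; simp [hx, hb0]

lemma mk_e0 (n : ℕ) (hn : 0 < n) :
    mk n (Pi.single ⟨0, hn⟩ 1) (Pi.single ⟨0, hn⟩ 1) = -1 := by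
  rw [mk_single]; simp [sg]

/-- adapted frame for a unit pair -/
lemma frame_unit (n : ℕ) (hn : 0 < n) (u v : Fin n → ℝ) (hu : mk n u u = -1) (hv : mk n v v = -1)
    (hu0 : 0 < u ⟨0, hn⟩) (hv0 : 0 < v ⟨0, hn⟩) :
    ∃ (L : (Fin n → ℝ) →ₗ[ℝ] (Fin n → ℝ)) (k : ℝ), (∀ x y, mk n (L x) (L y) = mk n x y) ∧
      L (u + v) = k • Pi.single ⟨0, hn⟩ 1 ∧ (L (u - v)) ⟨0, hn⟩ = 0 ∧
      (∀ a b, a ≠ b → L (u - v) a * L (u - v) b = 0) := by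
  have huv := mk_neg n hn u v (by linarith) (by linarith) hu0 hv0
  set e : Fin n → ℝ := Pi.single ⟨0, hn⟩ 1 with he
  have hee : mk n e e = -1 := mk_e0 n hn
  have hmm : mk n (u + v) (u + v) < 0 := by
    simp only [mk_add_left, mk_add_right, mk_comm n v u]; linarith
  set r := Real.sqrt (-mk n (u + v) (u + v)) with hr
  have hrpos : 0 < r := Real.sqrt_pos.2 (by linarith)
  have hr2 : r * r = -mk n (u + v) (u + v) := Real.mul_self_sqrt (by linarith)
  have hme : mk n (u + v) e = -(u ⟨0, hn⟩ + v ⟨0, hn⟩) := by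
    rw [he, mk_single]; simp [sg]
  obtain ⟨L, h1, h2, -⟩ := householder n (u + v) ((-r) • e)
    (by rw [mk_smul_left, mk_smul_right, hee]; linarith)
    (by
      simp only [mk_sub_left (u := u + v), mk_sub_right (u := u + v), mk_smul_left, mk_smul_right,
        mk_comm n e (u + v), hme, hee]
      have : 0 < r * (u ⟨0, hn⟩ + v ⟨0, hn⟩) := by positivity
      nlinarith)
  have hd0 : (L (u - v)) ⟨0, hn⟩ = 0 := by
    have h3 : mk n (L (u - v)) (L (u + v)) = 0 := by
      rw [h1]
      simp only [mk_sub_left, mk_add_right, mk_comm n v u]; linarith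
    rw [h2, mk_smul_right, he, mk_single] at h3
    have h4 : r * (L (u - v) ⟨0, hn⟩) = 0 := by
      simp only [sg] at h3
      simp only [if_true] at h3
      linarith
    exact (mul_eq_zero.1 h4).resolve_left hrpos.ne'
  obtain ⟨L', g1, g2, g3, g4⟩ := spatial_normal n hn (L (u - v)) hd0
  refine ⟨L' ∘ₗ L, -r, fun x y => by simp [g1, h1], ?_, g3, g4⟩
  rw [LinearMap.comp_apply, h2, map_smul, g2]

lemma expand (n : ℕ) (L : (Fin n → ℝ) →ₗ[ℝ] (Fin n → ℝ))
    (hL : ∀ x y, mk n (L x) (L y) = mk n x y) (x : Fin n → ℝ) (μ : Fin n) :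
    x μ = ∑ a, L x a * (sg n a * sg n μ * L (Pi.single μ 1) a) := by
  have h := hL x (Pi.single μ 1)
  rw [mk_single] at h
  calc x μ = sg n μ * (sg n μ * x μ) := by rw [← mul_assoc, sg_sq, one_mul]
    _ = _ := by
      rw [← h, mk, Finset.mul_sum]
      exact Finset.sum_congr rfl fun _ _ => by ring

lemma prod_sg (n : ℕ) (hn : 0 < n) (s : Finset (Fin n)) :
    ∏ a ∈ s, sg n a = if ⟨0, hn⟩ ∈ s then -1 else 1 := by
  have : ∀ a : Fin n, sg n a = if a = ⟨0, hn⟩ then -1 else 1 := by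
    intro a; simp [sg, Fin.ext_iff]
  simp_rw [this]
  rw [Finset.prod_ite_eq' s ⟨0, hn⟩ (fun _ => (-1 : ℝ))]

/-- adapted frame: simultaneous diagonalisation -/
lemma frame (n : ℕ) (hn : 0 < n) (u v : Fin n → ℝ) (hu : mk n u u < 0) (hv : mk n v v < 0)
    (hu0 : 0 < u ⟨0, hn⟩) (hv0 : 0 < v ⟨0, hn⟩) :
    ∃ (M : Fin n → Fin n → ℝ) (lam : Fin n → ℝ),
      (∀ μ ν, gmet n μ ν = ∑ a, sg n a * (M a μ * M a ν)) ∧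
      (∀ μ ν, (u μ * v ν + v μ * u ν) / 2 = ∑ a, lam a * (M a μ * M a ν)) ∧
      mk n u v = ∑ a, sg n a * lam a ∧
      ∀ s : Finset (Fin n),
        0 < (∏ a ∈ s, sg n a) * (∑ a ∈ s, sg n a * lam a - (∑ a, sg n a * lam a) / 2) := by
  set r := Real.sqrt (-mk n u u) with hr
  set t := Real.sqrt (-mk n v v) with ht
  have hrp : 0 < r := Real.sqrt_pos.2 (by linarith)
  have htp : 0 < t := Real.sqrt_pos.2 (by linarith)
  have hr2 : r * r = -mk n u u := Real.mul_self_sqrt (by linarith)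
  have ht2 : t * t = -mk n v v := Real.mul_self_sqrt (by linarith)
  obtain ⟨u', hu'⟩ : ∃ u', u' = r⁻¹ • u := ⟨_, rfl⟩
  obtain ⟨v', hv'⟩ : ∃ v', v' = t⁻¹ • v := ⟨_, rfl⟩
  have hru : u = r • u' := by rw [hu', smul_smul, mul_inv_cancel₀ hrp.ne', one_smul]
  have htv : v = t • v' := by rw [hv', smul_smul, mul_inv_cancel₀ htp.ne', one_smul]
  have huu : mk n u' u' = -1 := by
    rw [hu', mk_smul_left, mk_smul_right]; field_simp; nlinarith
  have hvv : mk n v' v' = -1 := by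
    rw [hv', mk_smul_left, mk_smul_right]; field_simp; nlinarith
  obtain ⟨L, k, h1, h2, h3, h4⟩ := frame_unit n hn u' v' huu hvv
    (by rw [hu']; simp; positivity) (by rw [hv']; simp; positivity)
  set y := L (u' - v') with hy
  set c := r * t / 4 with hc
  have hcp : 0 < c := by positivity
  have hY : mk n y y = ∑ a, y a ^ 2 := mk_self_nonneg n hn y h3
  have hkk : mk n (L (u' + v')) (L (u' + v')) = - k ^ 2 := by
    rw [h2, mk_smul_left, mk_smul_right, mk_e0]; ring
  have hsum : - k ^ 2 - ∑ a, y a ^ 2 = 4 * mk n u' v' := by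
    rw [← hkk, ← hY, hy, h1, h1]
    simp only [mk_sub_left, mk_sub_right, mk_add_left, mk_add_right, mk_comm n v' u']; ring
  have hdiff : - k ^ 2 + ∑ a, y a ^ 2 = -4 := by
    rw [← hkk, ← hY, hy, h1, h1]
    simp only [mk_sub_left, mk_sub_right, mk_add_left, mk_add_right, mk_comm n v' u']; linarith
  let lam : Fin n → ℝ := fun a => c * ((if a = ⟨0, hn⟩ then k ^ 2 else 0) - y a ^ 2)
  have hlam : ∀ a, sg n a * lam a = -c * ((if a = ⟨0, hn⟩ then k ^ 2 else 0) + y a ^ 2) := by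
    intro a
    simp only [lam]
    by_cases ha : a = ⟨0, hn⟩
    · subst ha; simp [sg, h3]
    · have : sg n a = 1 := by
        unfold sg; rw [if_neg]; intro h; exact ha (Fin.ext h)
      simp [ha, this]
  have hτ : ∑ a, sg n a * lam a = -c * (k ^ 2 + ∑ a, y a ^ 2) := by
    simp_rw [hlam]
    rw [← Finset.mul_sum, Finset.sum_add_distrib]; simp
  refine ⟨fun a μ => sg n a * sg n μ * L (Pi.single μ 1) a, lam, ?_, ?_, ?_, ?_⟩
  · intro μ ν
    have h := h1 (Pi.single μ 1) (Pi.single ν 1)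
    rw [mk_single] at h
    calc gmet n μ ν = sg n μ * sg n ν * (sg n ν * (Pi.single μ 1 : Fin n → ℝ) ν) := by
          rw [gmet_eq, Pi.single_apply]
          by_cases hμ : μ = ν
          · subst hμ; simp; rw [sg_sq, one_mul]
          · simp [hμ, Ne.symm hμ]
      _ = _ := by
          rw [← h, mk, Finset.mul_sum]
          refine Finset.sum_congr rfl fun a _ => ?_
          linear_combination (-sg n μ * sg n ν * sg n a * L (Pi.single μ 1) a *
            L (Pi.single ν 1) a) * sg_sq n a
  · intro μ ν
    have em := expand n L h1 (u' + v')
    have ed := expand n L h1 (u' - v')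
    rw [h2] at em
    rw [← hy] at ed
    generalize hM : (fun a μ => sg n a * sg n μ * L (Pi.single μ 1) a) = M
    have hM' : ∀ a μ, sg n a * sg n μ * L (Pi.single μ 1) a = M a μ := by
      intro a μ; rw [← hM]
    simp only [hM'] at em ed ⊢
    have em' : ∀ μ, (u' + v') μ = k * M ⟨0, hn⟩ μ := by
      intro μ; rw [em]; simp [Pi.single_apply]
    have edd : (u' - v') μ * (u' - v') ν = ∑ a, y a ^ 2 * (M a μ * M a ν) := by
      rw [ed μ, ed ν, Finset.sum_mul_sum]
      refine Finset.sum_congr rfl fun a _ => ?_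
      rw [Finset.sum_eq_single a]
      · ring
      · intro b _ hb
        linear_combination (M a μ * M b ν) * h4 a b hb.symm
      · simp
    have : (u μ * v ν + v μ * u ν) / 2 =
        c * ((u' + v') μ * (u' + v') ν - (u' - v') μ * (u' - v') ν) := by
      rw [hru, htv]; simp [hc]; ring
    rw [this, edd, em', em']
    simp only [lam, mul_sub, sub_mul, Finset.sum_sub_distrib, Finset.mul_sum]
    congr 1
    · simp; ring
    · exact Finset.sum_congr rfl fun _ _ => by ring
  · rw [hτ, hru, htv, mk_smul_left, mk_smul_right, hc]
    linear_combination (-(r * t / 4)) * hsum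
  · intro s
    rw [hτ, prod_sg n hn]
    simp_rw [hlam]
    rw [← Finset.mul_sum, Finset.sum_add_distrib, Finset.sum_ite_eq']
    have hp1 : ∑ a ∈ s, y a ^ 2 ≤ ∑ a, y a ^ 2 :=
      Finset.sum_le_sum_of_subset_of_nonneg (Finset.subset_univ _) (fun _ _ _ => sq_nonneg _)
    have hp0 : 0 ≤ ∑ a ∈ s, y a ^ 2 := Finset.sum_nonneg (fun _ _ => sq_nonneg _)
    generalize ∑ a ∈ s, y a ^ 2 = A at *
    generalize ∑ a, y a ^ 2 = Y at *
    split_ifs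
    · have : 0 < c * (k ^ 2 - Y + 2 * A) := by apply mul_pos hcp; linarith
      nlinarith
    · have : 0 < c * (k ^ 2 + Y - 2 * A) := by apply mul_pos hcp; linarith
      nlinarith

/-- the kernel in one block -/
def ker (n p : ℕ) (hp : 0 < p) (u v : Fin n → ℝ) (ρ ρ' : Fin p → Fin n) : ℝ :=
  u (ρ ⟨0, hp⟩) * v (ρ' ⟨0, hp⟩) *
    ∏ i ∈ Finset.univ.filter (fun i => i ≠ (⟨0, hp⟩ : Fin p)), gmet n (ρ i) (ρ' i)

def gker (n p : ℕ) (ρ ρ' : Fin p → Fin n) : ℝ := ∏ i : Fin p, gmet n (ρ i) (ρ' i)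

lemma gmet_comm (n : ℕ) (μ ν : Fin n) : gmet n μ ν = gmet n ν μ := by
  simp only [gmet_eq, eq_comm (a := μ)]
  split_ifs with h
  · rw [h]
  · rfl

lemma gker_comm (n p : ℕ) (ρ ρ' : Fin p → Fin n) : gker n p ρ ρ' = gker n p ρ' ρ := by
  unfold gker; exact Finset.prod_congr rfl fun _ _ => gmet_comm ..

lemma ker_comm (n p : ℕ) (hp : 0 < p) (u v : Fin n → ℝ) (ρ ρ' : Fin p → Fin n) :
    ker n p hp u v ρ' ρ = ker n p hp v u ρ ρ' := by
  unfold ker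
  rw [mul_comm (u _)]
  congr 1
  exact Finset.prod_congr rfl fun _ _ => gmet_comm ..

lemma prod_split (p : ℕ) (hp : 0 < p) (f : Fin p → ℝ) :
    ∏ i, f i = f ⟨0, hp⟩ * ∏ i ∈ Finset.univ.filter (fun i => i ≠ (⟨0, hp⟩ : Fin p)), f i := by
  rw [Finset.filter_ne', Finset.mul_prod_erase _ _ (Finset.mem_univ _)]

lemma prod_sum_eq (n p : ℕ) (f : Fin p → Fin n → ℝ) :
    ∏ i, ∑ a, f i a = ∑ a : Fin p → Fin n, ∏ i, f i (a i) := by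
  rw [Finset.prod_univ_sum, Fintype.piFinset_univ]

/-- diagonal weights -/
def wt (n p : ℕ) (hp : 0 < p) (lam : Fin n → ℝ) (a : Fin p → Fin n) : ℝ :=
  (∏ i, sg n (a i)) * (sg n (a ⟨0, hp⟩) * lam (a ⟨0, hp⟩) - (∑ b, sg n b * lam b) / (2 * p))

lemma block_diag (n p : ℕ) (hp : 0 < p) (u v : Fin n → ℝ) (M : Fin n → Fin n → ℝ)
    (lam : Fin n → ℝ)
    (h1 : ∀ μ ν, gmet n μ ν = ∑ a, sg n a * (M a μ * M a ν))
    (h2 : ∀ μ ν, (u μ * v ν + v μ * u ν) / 2 = ∑ a, lam a * (M a μ * M a ν))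
    (h3 : mk n u v = ∑ a, sg n a * lam a) (ρ ρ' : Fin p → Fin n) :
    (ker n p hp u v ρ ρ' + ker n p hp v u ρ ρ') / 2 - mk n u v / (2 * p) * gker n p ρ ρ' =
      ∑ a : Fin p → Fin n, wt n p hp lam a * ((∏ i, M (a i) (ρ i)) * ∏ i, M (a i) (ρ' i)) := by
  have hg : gker n p ρ ρ' =
      ∑ a : Fin p → Fin n, (∏ i, sg n (a i)) *
        ((∏ i, M (a i) (ρ i)) * ∏ i, M (a i) (ρ' i)) := by
    unfold gker
    simp_rw [h1]
    rw [prod_sum_eq]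
    simp_rw [Finset.prod_mul_distrib]
  have hk : (ker n p hp u v ρ ρ' + ker n p hp v u ρ ρ') / 2 =
      ∑ a : Fin p → Fin n, (∏ i, sg n (a i)) * (sg n (a ⟨0, hp⟩) * lam (a ⟨0, hp⟩)) *
        ((∏ i, M (a i) (ρ i)) * ∏ i, M (a i) (ρ' i)) := by
    calc _ = ∏ i, ∑ a, (if i = ⟨0, hp⟩ then lam a else sg n a) * (M a (ρ i) * M a (ρ' i)) := by
          rw [prod_split p hp]
          simp only [if_true]
          rw [← h2]
          unfold ker
          rw [← add_mul, mul_div_right_comm]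
          congr 1
          refine Finset.prod_congr rfl fun i hi => ?_
          simp only [if_neg (Finset.mem_filter.1 hi).2, h1]
      _ = _ := by
          rw [prod_sum_eq]
          refine Finset.sum_congr rfl fun a _ => ?_
          rw [Finset.prod_mul_distrib, Finset.prod_mul_distrib]
          congr 1
          rw [prod_split p hp, prod_split p hp (fun i => sg n (a i)), if_pos rfl]
          have : ∏ i ∈ Finset.univ.filter (fun i => i ≠ (⟨0, hp⟩ : Fin p)),
              (if i = ⟨0, hp⟩ then lam (a i) else sg n (a i)) =
              ∏ i ∈ Finset.univ.filter (fun i => i ≠ (⟨0, hp⟩ : Fin p)), sg n (a i) :=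
            Finset.prod_congr rfl fun i hi => by rw [if_neg (Finset.mem_filter.1 hi).2]
          rw [this]
          linear_combination (-(lam (a ⟨0, hp⟩) *
            ∏ i ∈ Finset.univ.filter (fun i => i ≠ (⟨0, hp⟩ : Fin p)), sg n (a i))) *
              sg_sq n (a ⟨0, hp⟩)
  rw [hk, hg, h3, Finset.mul_sum, ← Finset.sum_sub_distrib]
  refine Finset.sum_congr rfl fun a _ => ?_
  unfold wt; ring

/-- averaged weights -/
def awt (n p : ℕ) (lam : Fin n → ℝ) (a : Fin p → Fin n) : ℝ :=
  (∏ i, sg n (a i)) * ((∑ i, sg n (a i) * lam (a i)) - (∑ b, sg n b * lam b) / 2) / p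

lemma sum_wt (n p : ℕ) (hp : 0 < p) (lam : Fin n → ℝ) (f : (Fin p → Fin n) → ℝ)
    (hf : ∀ (π : Equiv.Perm (Fin p)) a, f (a ∘ π) = f a) :
    ∑ a, wt n p hp lam a * f a = ∑ a, awt n p lam a * f a := by
  have hp' : (p : ℝ) ≠ 0 := by exact_mod_cast hp.ne'
  have key : ∀ j : Fin p, ∑ a, (∏ i, sg n (a i)) * (sg n (a j) * lam (a j)) * f a =
      ∑ a, (∏ i, sg n (a i)) * (sg n (a ⟨0, hp⟩) * lam (a ⟨0, hp⟩)) * f a := by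
    intro j
    let π : Equiv.Perm (Fin p) := Equiv.swap ⟨0, hp⟩ j
    refine Fintype.sum_equiv (Equiv.arrowCongr π (Equiv.refl _)) _ _ fun a => ?_
    have e : (Equiv.arrowCongr π (Equiv.refl (Fin n))) a = a ∘ π := by
      funext i; simp [Equiv.arrowCongr, π]
    rw [e, hf]
    have e2 : ∏ i, sg n ((a ∘ π) i) = ∏ i, sg n (a i) := Equiv.prod_comp π (fun i => sg n (a i))
    have e3 : (a ∘ π) ⟨0, hp⟩ = a j := by simp [π]
    rw [e2, e3]
  have tot : ∑ a, (∏ i, sg n (a i)) * (∑ j, sg n (a j) * lam (a j)) * f a =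
      p * ∑ a, (∏ i, sg n (a i)) * (sg n (a ⟨0, hp⟩) * lam (a ⟨0, hp⟩)) * f a := by
    simp_rw [Finset.mul_sum (s := (Finset.univ : Finset (Fin p))), Finset.sum_mul]
    rw [Finset.sum_comm, Finset.sum_congr rfl (fun j _ => key j)]
    simp
  have l1 : ∑ a, wt n p hp lam a * f a =
      ∑ a, (∏ i, sg n (a i)) * (sg n (a ⟨0, hp⟩) * lam (a ⟨0, hp⟩)) * f a -
      (∑ b, sg n b * lam b) / (2 * p) * ∑ a, (∏ i, sg n (a i)) * f a := by
    rw [Finset.mul_sum, ← Finset.sum_sub_distrib]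
    exact Finset.sum_congr rfl fun a _ => by unfold wt; ring
  have l2 : ∑ a, awt n p lam a * f a =
      (∑ a, (∏ i, sg n (a i)) * (∑ j, sg n (a j) * lam (a j)) * f a) / p -
      (∑ b, sg n b * lam b) / (2 * p) * ∑ a, (∏ i, sg n (a i)) * f a := by
    rw [Finset.mul_sum, Finset.sum_div, ← Finset.sum_sub_distrib]
    exact Finset.sum_congr rfl fun a _ => by unfold awt; field_simp
  rw [l1, l2, tot, mul_div_cancel_left₀ _ hp']

lemma awt_pos (n p : ℕ) (hp : 0 < p) (lam : Fin n → ℝ)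
    (h : ∀ s : Finset (Fin n),
        0 < (∏ a ∈ s, sg n a) * (∑ a ∈ s, sg n a * lam a - (∑ a, sg n a * lam a) / 2))
    (a : Fin p → Fin n) (ha : Function.Injective a) : 0 < awt n p lam a := by
  have := h (Finset.univ.image a)
  rw [Finset.prod_image (fun _ _ _ _ e => ha e), Finset.sum_image (fun _ _ _ _ e => ha e)] at this
  unfold awt
  have hp' : (0 : ℝ) < p := by exact_mod_cast hp
  positivity

/-- change of frame in one block -/
def tr (n p : ℕ) (M : Fin n → Fin n → ℝ) (F : (Fin p → Fin n) → ℝ) (a : Fin p → Fin n) : ℝ :=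
  ∑ ρ, (∏ i, M (a i) (ρ i)) * F ρ

lemma tr_comp (n p : ℕ) (M : Fin n → Fin n → ℝ) (F : (Fin p → Fin n) → ℝ)
    (π : Equiv.Perm (Fin p)) (c : ℝ) (hF : ∀ ρ, F (ρ ∘ π) = c * F ρ) (a : Fin p → Fin n) :
    tr n p M F (a ∘ π) = c * tr n p M F a := by
  unfold tr
  rw [Finset.mul_sum]
  symm
  refine Fintype.sum_equiv (Equiv.arrowCongr π.symm (Equiv.refl _)) _ _ fun ρ => ?_
  have e : (Equiv.arrowCongr π.symm (Equiv.refl (Fin n))) ρ = ρ ∘ π := by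
    funext i; simp [Equiv.arrowCongr]
  rw [e, hF]
  have e2 : ∏ i, M ((a ∘ π) i) ((ρ ∘ π) i) = ∏ i, M (a i) (ρ i) :=
    Equiv.prod_comp π (fun i => M (a i) (ρ i))
  rw [e2]; ring

lemma tr_inj (n p : ℕ) (M : Fin n → Fin n → ℝ)
    (h1 : ∀ μ ν, gmet n μ ν = ∑ a, sg n a * (M a μ * M a ν))
    (F : (Fin p → Fin n) → ℝ) (h : ∀ a, tr n p M F a = 0) (τ : Fin p → Fin n) : F τ = 0 := by
  have e : ∑ a : Fin p → Fin n, (∏ i, sg n (τ i) * sg n (a i) * M (a i) (τ i)) * tr n p M F a =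
      F τ := by
    unfold tr
    simp_rw [Finset.mul_sum]
    rw [Finset.sum_comm]
    have : ∀ ρ : Fin p → Fin n, ∑ a : Fin p → Fin n,
        (∏ i, sg n (τ i) * sg n (a i) * M (a i) (τ i)) * ((∏ i, M (a i) (ρ i)) * F ρ) =
        if ρ = τ then F ρ else 0 := by
      intro ρ
      have e1 : ∀ a : Fin p → Fin n,
          (∏ i, sg n (τ i) * sg n (a i) * M (a i) (τ i)) * ((∏ i, M (a i) (ρ i)) * F ρ) =
          (∏ i, sg n (τ i) * (sg n (a i) * (M (a i) (τ i) * M (a i) (ρ i)))) * F ρ := by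
        intro a
        rw [← mul_assoc, ← Finset.prod_mul_distrib]
        congr 1
        exact Finset.prod_congr rfl fun _ _ => by ring
      simp_rw [e1]
      rw [← Finset.sum_mul,
        ← prod_sum_eq n p (fun i b => sg n (τ i) * (sg n b * (M b (τ i) * M b (ρ i))))]
      simp_rw [← Finset.mul_sum, ← h1]
      split_ifs with hρ
      · subst hρ
        simp [gmet_eq, sg_sq]
      · obtain ⟨i, hi⟩ : ∃ i, ρ i ≠ τ i := by
          by_contra hc; push Not at hc; exact hρ (funext hc)
        rw [Finset.prod_eq_zero (Finset.mem_univ i), zero_mul]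
        simp [gmet_eq, Ne.symm hi]
    rw [Finset.sum_congr rfl (fun ρ _ => this ρ)]
    simp
  rw [← e]
  simp [h]

/-- change of frame in both blocks -/
def tr2 (n p q : ℕ) (M N : Fin n → Fin n → ℝ) (K : (Fin p → Fin n) → (Fin q → Fin n) → ℝ)
    (a : Fin p → Fin n) (b : Fin q → Fin n) : ℝ :=
  tr n p M (fun ρ => tr n q N (K ρ) b) a

/-- contraction of `K K` against a kernel -/
def phi (n p q : ℕ) (K : (Fin p → Fin n) → (Fin q → Fin n) → ℝ)
    (X : (Fin p → Fin n) → (Fin p → Fin n) → (Fin q → Fin n) → (Fin q → Fin n) → ℝ) : ℝ :=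
  ∑ ρ, ∑ ρ', ∑ σ, ∑ σ', K ρ σ * K ρ' σ' * X ρ ρ' σ σ'

lemma phi_swap (n p q : ℕ) (K : (Fin p → Fin n) → (Fin q → Fin n) → ℝ)
    (X : (Fin p → Fin n) → (Fin p → Fin n) → (Fin q → Fin n) → (Fin q → Fin n) → ℝ) :
    phi n p q K (fun ρ ρ' σ σ' => X ρ' ρ σ' σ) = phi n p q K X := by
  unfold phi
  rw [Finset.sum_comm]
  refine Finset.sum_congr rfl fun ρ _ => Finset.sum_congr rfl fun ρ' _ => ?_
  rw [Finset.sum_comm]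
  exact Finset.sum_congr rfl fun σ _ => Finset.sum_congr rfl fun σ' _ => by ring

lemma phi_add (n p q : ℕ) (K : (Fin p → Fin n) → (Fin q → Fin n) → ℝ)
    (X Y : (Fin p → Fin n) → (Fin p → Fin n) → (Fin q → Fin n) → (Fin q → Fin n) → ℝ) :
    phi n p q K (fun ρ ρ' σ σ' => X ρ ρ' σ σ' + Y ρ ρ' σ σ') =
      phi n p q K X + phi n p q K Y := by
  simp only [phi, mul_add, Finset.sum_add_distrib]

lemma phi_smul (n p q : ℕ) (K : (Fin p → Fin n) → (Fin q → Fin n) → ℝ) (c : ℝ)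
    (X : (Fin p → Fin n) → (Fin p → Fin n) → (Fin q → Fin n) → (Fin q → Fin n) → ℝ) :
    phi n p q K (fun ρ ρ' σ σ' => c * X ρ ρ' σ σ') = c * phi n p q K X := by
  simp only [phi, Finset.mul_sum]
  refine Finset.sum_congr rfl fun _ _ => Finset.sum_congr rfl fun _ _ =>
    Finset.sum_congr rfl fun _ _ => Finset.sum_congr rfl fun _ _ => by ring

/-- contraction of `K K` against a product of diagonalised kernels -/
lemma phi_diag (n p q : ℕ) (K : (Fin p → Fin n) → (Fin q → Fin n) → ℝ)
    (M N : Fin n → Fin n → ℝ) (V : (Fin p → Fin n) → ℝ) (W : (Fin q → Fin n) → ℝ) :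
    phi n p q K (fun ρ ρ' σ σ' =>
      (∑ a : Fin p → Fin n, V a * ((∏ i, M (a i) (ρ i)) * ∏ i, M (a i) (ρ' i))) *
      (∑ b : Fin q → Fin n, W b * ((∏ i, N (b i) (σ i)) * ∏ i, N (b i) (σ' i)))) =
    ∑ a, V a * ∑ b, W b * (tr2 n p q M N K a b) ^ 2 := by
  have hsq : ∀ a b, (tr2 n p q M N K a b) ^ 2 = phi n p q K (fun ρ ρ' σ σ' =>
      ((∏ i, M (a i) (ρ i)) * ∏ i, M (a i) (ρ' i)) *
      ((∏ i, N (b i) (σ i)) * ∏ i, N (b i) (σ' i))) := by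
    intro a b
    rw [sq, tr2, tr, Finset.sum_mul_sum, phi]
    refine Finset.sum_congr rfl fun ρ _ => Finset.sum_congr rfl fun ρ' _ => ?_
    unfold tr
    rw [mul_mul_mul_comm, Finset.sum_mul_sum, Finset.mul_sum]
    refine Finset.sum_congr rfl fun σ _ => ?_
    rw [Finset.mul_sum]
    exact Finset.sum_congr rfl fun σ' _ => by ring
  have hlin : ∀ {ι : Type} (s : Finset ι)
      (X : ι → (Fin p → Fin n) → (Fin p → Fin n) → (Fin q → Fin n) → (Fin q → Fin n) → ℝ),
      phi n p q K (fun ρ ρ' σ σ' => ∑ i ∈ s, X i ρ ρ' σ σ') = ∑ i ∈ s, phi n p q K (X i) := by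
    intro ι s X
    classical
    induction s using Finset.induction_on with
    | empty => simp [phi]
    | insert i s hi ih =>
      simp only [Finset.sum_insert hi]
      rw [phi_add, ih]
  simp_rw [hsq, ← phi_smul, ← hlin, ← phi_smul]
  rw [← hlin]
  congr 1
  funext ρ ρ' σ σ'
  rw [Finset.sum_mul]
  refine Finset.sum_congr rfl fun a _ => ?_
  rw [Finset.mul_sum]
  simp_rw [Finset.mul_sum]
  exact Finset.sum_congr rfl fun b _ => by ring

section contractions

variable (n p q : ℕ) (hp : 0 < p) (hq : 0 < q) (K : (Fin p → Fin n) → (Fin q → Fin n) → ℝ)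
  (w₁ w₂ w₃ w₄ : Fin n → ℝ)

lemma con11 : ∑ α, ∑ β, ∑ l, ∑ m, dCon11 n p q hp hq K α β l m * (w₁ α * w₂ β * w₃ l * w₄ m) =
    phi n p q K (fun ρ ρ' σ σ' => ker n p hp w₁ w₂ ρ ρ' * ker n q hq w₃ w₄ σ σ') := by
  have e : ∀ α β l m, dCon11 n p q hp hq K α β l m * (w₁ α * w₂ β * w₃ l * w₄ m) =
      ∑ t : (Fin p → Fin n) × (Fin p → Fin n) × (Fin q → Fin n) × (Fin q → Fin n),
        if t.1 ⟨0, hp⟩ = α then (if t.2.1 ⟨0, hp⟩ = β then (if t.2.2.1 ⟨0, hq⟩ = l then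
          (if t.2.2.2 ⟨0, hq⟩ = m then K t.1 t.2.2.1 * K t.2.1 t.2.2.2 *
            (ker n p hp w₁ w₂ t.1 t.2.1 * ker n q hq w₃ w₄ t.2.2.1 t.2.2.2) else 0) else 0)
            else 0) else 0 := by
    intro α β l m
    simp only [Fintype.sum_prod_type, dCon11, Finset.sum_mul]
    refine Finset.sum_congr rfl fun ρ _ => Finset.sum_congr rfl fun ρ' _ =>
      Finset.sum_congr rfl fun σ _ => Finset.sum_congr rfl fun σ' _ => ?_
    simp only [ite_and]
    split_ifs with h1 h2 h3 h4
    · rw [← h1, ← h2, ← h3, ← h4]; unfold ker; ring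
    all_goals simp
  simp only [e]
  simp_rw [Finset.sum_comm (t := (Finset.univ :
    Finset ((Fin p → Fin n) × (Fin p → Fin n) × (Fin q → Fin n) × (Fin q → Fin n))))]
  simp [Fintype.sum_prod_type, phi]

lemma con01 : ∑ l, ∑ m, dCon01 n p q hq K l m * (w₃ l * w₄ m) =
    phi n p q K (fun ρ ρ' σ σ' => gker n p ρ ρ' * ker n q hq w₃ w₄ σ σ') := by
  have e : ∀ l m, dCon01 n p q hq K l m * (w₃ l * w₄ m) =
      ∑ t : (Fin p → Fin n) × (Fin p → Fin n) × (Fin q → Fin n) × (Fin q → Fin n),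
        if t.2.2.1 ⟨0, hq⟩ = l then
          (if t.2.2.2 ⟨0, hq⟩ = m then K t.1 t.2.2.1 * K t.2.1 t.2.2.2 *
            (gker n p t.1 t.2.1 * ker n q hq w₃ w₄ t.2.2.1 t.2.2.2) else 0) else 0 := by
    intro l m
    simp only [Fintype.sum_prod_type, dCon01, Finset.sum_mul]
    refine Finset.sum_congr rfl fun ρ _ => Finset.sum_congr rfl fun ρ' _ =>
      Finset.sum_congr rfl fun σ _ => Finset.sum_congr rfl fun σ' _ => ?_
    simp only [ite_and]
    split_ifs with h1 h2
    · rw [← h1, ← h2]; unfold ker gker; ring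
    all_goals simp
  simp only [e]
  simp_rw [Finset.sum_comm (t := (Finset.univ :
    Finset ((Fin p → Fin n) × (Fin p → Fin n) × (Fin q → Fin n) × (Fin q → Fin n))))]
  simp [Fintype.sum_prod_type, phi]

lemma con10 : ∑ α, ∑ β, dCon10 n p q hp K α β * (w₁ α * w₂ β) =
    phi n p q K (fun ρ ρ' σ σ' => ker n p hp w₁ w₂ ρ ρ' * gker n q σ σ') := by
  have e : ∀ α β, dCon10 n p q hp K α β * (w₁ α * w₂ β) =
      ∑ t : (Fin p → Fin n) × (Fin p → Fin n) × (Fin q → Fin n) × (Fin q → Fin n),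
        if t.1 ⟨0, hp⟩ = α then
          (if t.2.1 ⟨0, hp⟩ = β then K t.1 t.2.2.1 * K t.2.1 t.2.2.2 *
            (ker n p hp w₁ w₂ t.1 t.2.1 * gker n q t.2.2.1 t.2.2.2) else 0) else 0 := by
    intro α β
    simp only [Fintype.sum_prod_type, dCon10, Finset.sum_mul]
    refine Finset.sum_congr rfl fun ρ _ => Finset.sum_congr rfl fun ρ' _ =>
      Finset.sum_congr rfl fun σ _ => Finset.sum_congr rfl fun σ' _ => ?_
    simp only [ite_and]
    split_ifs with h1 h2
    · rw [← h1, ← h2]; unfold ker gker; ring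
    all_goals simp
  simp only [e]
  simp_rw [Finset.sum_comm (t := (Finset.univ :
    Finset ((Fin p → Fin n) × (Fin p → Fin n) × (Fin q → Fin n) × (Fin q → Fin n))))]
  simp [Fintype.sum_prod_type, phi]

lemma con00 : dCon00 n p q K =
    phi n p q K (fun ρ ρ' σ σ' => gker n p ρ ρ' * gker n q σ σ') := by
  unfold dCon00 phi gker
  exact Finset.sum_congr rfl fun ρ _ => Finset.sum_congr rfl fun ρ' _ =>
      Finset.sum_congr rfl fun σ _ => Finset.sum_congr rfl fun σ' _ => by ring

lemma sum_gmet : ∑ α, ∑ β, gmet n α β * (w₁ α * w₂ β) = mk n w₁ w₂ := by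
  simp [mk, gmet_eq, mul_assoc]

lemma sum_prod (f g : Fin n → Fin n → ℝ) :
    ∑ α, ∑ β, ∑ l, ∑ m, (f α β * g l m) = (∑ α, ∑ β, f α β) * ∑ l, ∑ m, g l m := by
  simp_rw [Finset.sum_mul]
  simp_rw [Finset.mul_sum]

lemma total_eq : ∑ α, ∑ β, ∑ l, ∑ m, seTK n p q hp hq K α β l m * w₁ α * w₂ β * w₃ l * w₄ m =
    (1 / (((p - 1).factorial : ℝ) * ((q - 1).factorial : ℝ))) *
    (phi n p q K (fun ρ ρ' σ σ' => ker n p hp w₁ w₂ ρ ρ' * ker n q hq w₃ w₄ σ σ') +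
     phi n p q K (fun ρ ρ' σ σ' => ker n p hp w₁ w₂ ρ ρ' * ker n q hq w₄ w₃ σ σ')
     - (1 / (p : ℝ)) * mk n w₁ w₂ *
        phi n p q K (fun ρ ρ' σ σ' => gker n p ρ ρ' * ker n q hq w₃ w₄ σ σ')
     - (1 / (q : ℝ)) * mk n w₃ w₄ *
        phi n p q K (fun ρ ρ' σ σ' => ker n p hp w₁ w₂ ρ ρ' * gker n q σ σ')
     + (1 / (2 * (p : ℝ) * (q : ℝ))) * mk n w₁ w₂ * mk n w₃ w₄ *
        phi n p q K (fun ρ ρ' σ σ' => gker n p ρ ρ' * gker n q σ σ')) := by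
  have s2 : ∑ α, ∑ β, ∑ l, ∑ m, dCon11 n p q hp hq K α β m l * (w₁ α * w₂ β * w₃ l * w₄ m) =
      phi n p q K (fun ρ ρ' σ σ' => ker n p hp w₁ w₂ ρ ρ' * ker n q hq w₄ w₃ σ σ') := by
    rw [← con11]
    refine Finset.sum_congr rfl fun α _ => Finset.sum_congr rfl fun β _ => ?_
    rw [Finset.sum_comm]
    exact Finset.sum_congr rfl fun _ _ => Finset.sum_congr rfl fun _ _ => by ring
  rw [← con11, ← s2, ← con01, ← con10, ← con00, mul_assoc (1 / (p : ℝ)), mul_assoc (1 / (q : ℝ)),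
    mul_comm (mk n w₃ w₄) (∑ α, ∑ β, dCon10 n p q hp K α β * (w₁ α * w₂ β)),
    mul_assoc (1 / (2 * (p : ℝ) * (q : ℝ))), ← sum_gmet n w₁ w₂, ← sum_gmet n w₃ w₄,
    ← sum_prod, ← sum_prod, ← sum_prod, mul_assoc, mul_comm _ (dCon00 n p q K)]
  simp only [Finset.mul_sum, ← Finset.sum_add_distrib, ← Finset.sum_sub_distrib]
  refine Finset.sum_congr rfl fun α _ => Finset.sum_congr rfl fun β _ =>
      Finset.sum_congr rfl fun l _ => Finset.sum_congr rfl fun m _ => ?_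
  unfold seTK
  ring

lemma total_eq2 :
    ∑ α, ∑ β, ∑ l, ∑ m, seTK n p q hp hq K α β l m * w₁ α * w₂ β * w₃ l * w₄ m =
    (2 / (((p - 1).factorial : ℝ) * ((q - 1).factorial : ℝ))) *
    phi n p q K (fun ρ ρ' σ σ' =>
      ((ker n p hp w₁ w₂ ρ ρ' + ker n p hp w₂ w₁ ρ ρ') / 2
        - mk n w₁ w₂ / (2 * p) * gker n p ρ ρ') *
      ((ker n q hq w₃ w₄ σ σ' + ker n q hq w₄ w₃ σ σ') / 2
        - mk n w₃ w₄ / (2 * q) * gker n q σ σ')) := by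
  rw [total_eq]
  have a1 : phi n p q K (fun ρ ρ' σ σ' => ker n p hp w₂ w₁ ρ ρ' * ker n q hq w₄ w₃ σ σ') =
      phi n p q K (fun ρ ρ' σ σ' => ker n p hp w₁ w₂ ρ ρ' * ker n q hq w₃ w₄ σ σ') := by
    rw [← phi_swap]; simp only [ker_comm]
  have a2 : phi n p q K (fun ρ ρ' σ σ' => ker n p hp w₂ w₁ ρ ρ' * ker n q hq w₃ w₄ σ σ') =
      phi n p q K (fun ρ ρ' σ σ' => ker n p hp w₁ w₂ ρ ρ' * ker n q hq w₄ w₃ σ σ') := by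
    rw [← phi_swap]; simp only [ker_comm]
  have a3 : phi n p q K (fun ρ ρ' σ σ' => gker n p ρ ρ' * ker n q hq w₄ w₃ σ σ') =
      phi n p q K (fun ρ ρ' σ σ' => gker n p ρ ρ' * ker n q hq w₃ w₄ σ σ') := by
    rw [← phi_swap]
    congr 1; funext ρ ρ' σ σ'; rw [ker_comm, gker_comm]
  have a4 : phi n p q K (fun ρ ρ' σ σ' => ker n p hp w₂ w₁ ρ ρ' * gker n q σ σ') =
      phi n p q K (fun ρ ρ' σ σ' => ker n p hp w₁ w₂ ρ ρ' * gker n q σ σ') := by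
    rw [← phi_swap]
    congr 1; funext ρ ρ' σ σ'; rw [ker_comm, gker_comm]
  generalize mk n w₁ w₂ = g at *
  generalize mk n w₃ w₄ = h at *
  have ex : (fun ρ ρ' σ σ' =>
      ((ker n p hp w₁ w₂ ρ ρ' + ker n p hp w₂ w₁ ρ ρ') / 2 - g / (2 * p) * gker n p ρ ρ') *
      ((ker n q hq w₃ w₄ σ σ' + ker n q hq w₄ w₃ σ σ') / 2 - h / (2 * q) * gker n q σ σ')) =
      (fun ρ ρ' σ σ' => (1 / 4) * (ker n p hp w₁ w₂ ρ ρ' * ker n q hq w₃ w₄ σ σ') +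
        ((1 / 4) * (ker n p hp w₁ w₂ ρ ρ' * ker n q hq w₄ w₃ σ σ') +
        ((1 / 4) * (ker n p hp w₂ w₁ ρ ρ' * ker n q hq w₃ w₄ σ σ') +
        ((1 / 4) * (ker n p hp w₂ w₁ ρ ρ' * ker n q hq w₄ w₃ σ σ') +
        ((-(g / (4 * p))) * (gker n p ρ ρ' * ker n q hq w₃ w₄ σ σ') +
        ((-(g / (4 * p))) * (gker n p ρ ρ' * ker n q hq w₄ w₃ σ σ') +
        ((-(h / (4 * q))) * (ker n p hp w₁ w₂ ρ ρ' * gker n q σ σ') +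
        ((-(h / (4 * q))) * (ker n p hp w₂ w₁ ρ ρ' * gker n q σ σ') +
        (g * h / (4 * p * q)) * (gker n p ρ ρ' * gker n q σ σ'))))))))) := by
    funext ρ ρ' σ σ'
    have hp' : (p : ℝ) ≠ 0 := by exact_mod_cast hp.ne'
    have hq' : (q : ℝ) ≠ 0 := by exact_mod_cast hq.ne'
    field_simp
    ring
  rw [ex]
  simp only [phi_add, phi_smul]
  rw [a1, a2, a3, a4]
  ring

end contractions

lemma antisymm_zero (n p : ℕ) (F : (Fin p → Fin n) → ℝ)
    (hF : ∀ (π : Equiv.Perm (Fin p)) ρ, F (ρ ∘ π) = ((Equiv.Perm.sign π : ℤ) : ℝ) * F ρ)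
    (a : Fin p → Fin n) (ha : ¬ Function.Injective a) : F a = 0 := by
  unfold Function.Injective at ha
  push Not at ha
  obtain ⟨i, j, hij, hne⟩ := ha
  have h := hF (Equiv.swap i j) a
  have e : a ∘ Equiv.swap i j = a := by
    funext k
    simp only [Function.comp_apply, Equiv.swap_apply_def]
    split_ifs with h1 h2
    · rw [h1, hij]
    · rw [h2, hij]
    · rfl
  rw [e, Equiv.Perm.sign_swap hne] at h
  norm_num at h
  linarith

lemma sign_sq (p : ℕ) (π : Equiv.Perm (Fin p)) :
    (((Equiv.Perm.sign π : ℤ) : ℝ)) ^ 2 = 1 := by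
  rcases Int.units_eq_one_or (Equiv.Perm.sign π) with h | h <;> simp [h]

lemma diag_pos (n p q : ℕ) (hp : 0 < p) (hq : 0 < q)
    (K : (Fin p → Fin n) → (Fin q → Fin n) → ℝ) (hK : IsDoubleForm n p q K) (hK0 : K ≠ 0)
    (lam lam' : Fin n → ℝ)
    (h : ∀ s : Finset (Fin n),
        0 < (∏ a ∈ s, sg n a) * (∑ a ∈ s, sg n a * lam a - (∑ a, sg n a * lam a) / 2))
    (h' : ∀ s : Finset (Fin n),
        0 < (∏ a ∈ s, sg n a) * (∑ a ∈ s, sg n a * lam' a - (∑ a, sg n a * lam' a) / 2)) :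
    0 < ∑ a, wt n p hp lam a * ∑ b, wt n q hq lam' b * (K a b) ^ 2 := by
  have e1 : ∀ a, ∑ b, wt n q hq lam' b * (K a b) ^ 2 = ∑ b, awt n q lam' b * (K a b) ^ 2 := by
    intro a
    refine sum_wt n q hq lam' _ fun π b => ?_
    rw [hK.2 π, mul_pow, sign_sq, one_mul]
  simp_rw [e1]
  rw [sum_wt n p hp lam _ (fun π a => by simp_rw [hK.1 π, mul_pow, sign_sq, one_mul])]
  simp_rw [Finset.mul_sum]
  have nn : ∀ a b, 0 ≤ awt n p lam a * (awt n q lam' b * K a b ^ 2) := by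
    intro a b
    by_cases ha : Function.Injective a
    · by_cases hb : Function.Injective b
      · have := awt_pos n p hp lam h a ha
        have := awt_pos n q hq lam' h' b hb
        positivity
      · rw [antisymm_zero n q (K a) (fun π ρ => hK.2 π a ρ) b hb]; simp
    · rw [antisymm_zero n p (fun x => K x b) (fun π ρ => hK.1 π ρ b) a ha]; simp
  obtain ⟨a, b, hab⟩ : ∃ a b, K a b ≠ 0 := by
    by_contra hc; push Not at hc
    exact hK0 (funext fun a => funext fun b => hc a b)
  refine Finset.sum_pos' (fun a _ => Finset.sum_nonneg fun b _ => nn a b)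
    ⟨a, Finset.mem_univ _, Finset.sum_pos' (fun b _ => nn a b) ⟨b, Finset.mem_univ _, ?_⟩⟩
  have ha : Function.Injective a := by
    by_contra hc
    exact hab (antisymm_zero n p (fun x => K x b) (fun π ρ => hK.1 π ρ b) a hc)
  have hb : Function.Injective b := by
    by_contra hc
    exact hab (antisymm_zero n q (K a) (fun π ρ => hK.2 π a ρ) b hc)
  have := awt_pos n p hp lam h a ha
  have := awt_pos n q hq lam' h' b hb
  positivity

lemma tr2_form (n p q : ℕ) (M N : Fin n → Fin n → ℝ)
    (K : (Fin p → Fin n) → (Fin q → Fin n) → ℝ) (hK : IsDoubleForm n p q K) :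
    IsDoubleForm n p q (tr2 n p q M N K) := by
  constructor
  · intro π a b
    unfold tr2
    refine tr_comp n p M _ π _ (fun ρ => ?_) a
    unfold tr
    rw [Finset.mul_sum]
    exact Finset.sum_congr rfl fun σ _ => by rw [hK.1 π]; ring
  · intro π a b
    unfold tr2
    have : ∀ ρ, tr n q N (K ρ) (b ∘ π) =
        ((Equiv.Perm.sign π : ℤ) : ℝ) * tr n q N (K ρ) b := fun ρ =>
      tr_comp n q N _ π _ (fun σ => hK.2 π ρ σ) b
    simp_rw [this]
    unfold tr
    rw [Finset.mul_sum]
    exact Finset.sum_congr rfl fun σ _ => by ring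

end SEProof

/-- strict positivity of the super-energy tensor of a nonzero double
`(p,q)`-form on quadruples of future-pointing timelike vectors. -/
theorem seTK_strictly_positive
    (n p q : ℕ) (hp : 1 ≤ p) (hpn : p ≤ n) (hq : 1 ≤ q) (hqn : q ≤ n)
    (K : (Fin p → Fin n) → (Fin q → Fin n) → ℝ) (hK : IsDoubleForm n p q K)
    (hK0 : K ≠ 0)
    (w₁ w₂ w₃ w₄ : Fin n → ℝ)
    (h₁t : minkSq n w₁ < 0) (h₁f : 0 < w₁ ⟨0, by omega⟩)
    (h₂t : minkSq n w₂ < 0) (h₂f : 0 < w₂ ⟨0, by omega⟩)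
    (h₃t : minkSq n w₃ < 0) (h₃f : 0 < w₃ ⟨0, by omega⟩)
    (h₄t : minkSq n w₄ < 0) (h₄f : 0 < w₄ ⟨0, by omega⟩) :
    0 < ∑ α : Fin n, ∑ β : Fin n, ∑ lam : Fin n, ∑ mu : Fin n,
          seTK n p q hp hq K α β lam mu * w₁ α * w₂ β * w₃ lam * w₄ mu := by
  have hn : 0 < n := by omega
  rw [SEProof.minkSq_eq] at h₁t h₂t h₃t h₄t
  obtain ⟨M, lam, a1, a2, a3, a4⟩ := SEProof.frame n hn w₁ w₂ h₁t h₂t h₁f h₂f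
  obtain ⟨N, lam', b1, b2, b3, b4⟩ := SEProof.frame n hn w₃ w₄ h₃t h₄t h₃f h₄f
  rw [SEProof.total_eq2 n p q hp hq K w₁ w₂ w₃ w₄]
  simp_rw [SEProof.block_diag n p hp w₁ w₂ M lam a1 a2 a3,
    SEProof.block_diag n q hq w₃ w₄ N lam' b1 b2 b3]
  rw [SEProof.phi_diag]
  refine mul_pos (by positivity) ?_
  refine SEProof.diag_pos n p q hp hq _ (SEProof.tr2_form n p q M N K hK) ?_ lam lam' a4 b4
  intro hc
  apply hK0
  funext ρ σ
  refine SEProof.tr_inj n q N b1 (K ρ) (fun b => ?_) σ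
  exact SEProof.tr_inj n p M a1 (fun ρ => SEProof.tr n q N (K ρ) b)
    (fun a => congrFun (congrFun hc a) b) ρ
end
end

section
/- Let 1 ≤ p ≤ n, let Σ be a p-form on n-dimensional Minkowski space, let u be a future-pointing unit timelike vector, and define the super-energy flux vector P^ν = −η^{νρ} T{Σ}_{ρμ} u^μ. Then P is causal, i.e. η_{μν}P^μP^ν ≤ 0; moreover, if Σ ≠ 0 then η_{μν}P^μu^ν < 0, so P is future-pointing (it has the same time orientation as u). -/
open Finset

noncomputable section

/-- A `p`-form: a totally antisymmetric `p`-index covariant tensor. -/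
def IsPForm (n p : ℕ) (S : (Fin p → Fin n) → ℝ) : Prop :=
  ∀ (σ : Equiv.Perm (Fin p)) (μ : Fin p → Fin n),
    S (μ ∘ σ) = ((Equiv.Perm.sign σ : ℤ) : ℝ) * S μ

/-- The contraction `Σ_{λρ₂…ρ_p} Σ_μ{}^{ρ₂…ρ_p}`. -/
def partContract (n p : ℕ) (hp : 0 < p) (S : (Fin p → Fin n) → ℝ) (lam mu : Fin n) : ℝ :=
  ∑ ρ : Fin p → Fin n, ∑ τ : Fin p → Fin n,
    if ρ ⟨0, hp⟩ = lam ∧ τ ⟨0, hp⟩ = mu then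
      S ρ * S τ *
        ∏ i ∈ Finset.univ.filter (fun i => i ≠ (⟨0, hp⟩ : Fin p)), gmet n (ρ i) (τ i)
    else 0

/-- The full contraction `Σ_{ρ₁…ρ_p} Σ^{ρ₁…ρ_p}`. -/
def fullContract (n p : ℕ) (S : (Fin p → Fin n) → ℝ) : ℝ :=
  ∑ ρ : Fin p → Fin n, ∑ τ : Fin p → Fin n,
    S ρ * S τ * ∏ i : Fin p, gmet n (ρ i) (τ i)

/-- The basic super-energy tensor `T{Σ}_{λμ}` of a `p`-form. -/
def seT (n p : ℕ) (hp : 0 < p) (S : (Fin p → Fin n) → ℝ) (lam mu : Fin n) : ℝ :=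
  (1 / ((p - 1).factorial : ℝ)) * partContract n p hp S lam mu
    - (1 / (2 * (p.factorial : ℝ))) * gmet n lam mu * fullContract n p S

/-- The super-energy flux vector `P^ν = −η^{νρ} T{Σ}_{ρμ} u^μ`. -/
def seFlux (n p : ℕ) (hp : 0 < p) (S : (Fin p → Fin n) → ℝ) (u : Fin n → ℝ) : Fin n → ℝ :=
  fun ν => -(∑ ρ : Fin n, ∑ mu : Fin n, gmet n ν ρ * seT n p hp S ρ mu * u mu)


/-- Diagonal entries of the metric. -/
def eps (n : ℕ) (m : Fin n) : ℝ := if (m : ℕ) = 0 then -1 else 1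

lemma gmet_eq (n : ℕ) (a b : Fin n) : gmet n a b = if a = b then eps n a else 0 := rfl

lemma eps_sq (n : ℕ) (m : Fin n) : eps n m * eps n m = 1 := by
  unfold eps; split_ifs <;> norm_num

/-- Product of metric signs. -/
def wt (n k : ℕ) (r : Fin k → Fin n) : ℝ := ∏ i, eps n (r i)

lemma prod_gmet (n k : ℕ) (r t : Fin k → Fin n) :
    ∏ i, gmet n (r i) (t i) = if r = t then wt n k r else 0 := by
  split_ifs with h
  · subst h; simp [gmet_eq, wt]
  · obtain ⟨i, hi⟩ := Function.ne_iff.1 h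
    exact Finset.prod_eq_zero (Finset.mem_univ i) (by simp [gmet_eq, hi])

lemma full_eq (n k : ℕ) (S : (Fin k → Fin n) → ℝ) :
    fullContract n k S = ∑ r, wt n k r * (S r * S r) := by
  unfold fullContract
  simp only [prod_gmet, mul_ite, mul_zero, Finset.sum_ite_eq, Finset.mem_univ, if_true]
  exact Finset.sum_congr rfl fun r _ => by ring

lemma sum_cons (n k : ℕ) (f : (Fin (k+1) → Fin n) → ℝ) :
    ∑ ρ, f ρ = ∑ a : Fin n, ∑ r : Fin k → Fin n, f (Fin.cons a r) := by
  rw [← Fintype.sum_prod_type' (f := fun a r => f (Fin.cons a r))]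
  exact (Fintype.sum_equiv (Fin.consEquiv (fun _ : Fin (k+1) => Fin n)) _ _ (fun x => rfl)).symm

lemma part_eq (n k : ℕ) (hp : 0 < k + 1) (S : (Fin (k+1) → Fin n) → ℝ) (lam mu : Fin n) :
    partContract n (k+1) hp S lam mu
      = ∑ r : Fin k → Fin n, wt n k r * (S (Fin.cons lam r) * S (Fin.cons mu r)) := by
  have h0 : (⟨0, hp⟩ : Fin (k+1)) = 0 := rfl
  unfold partContract
  rw [h0]
  simp only [sum_cons, Finset.prod_filter, Fin.prod_univ_succ, Fin.cons_zero, Fin.cons_succ]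
  simp only [ne_eq, not_true_eq_false, if_false, one_mul, Fin.succ_ne_zero, not_false_eq_true,
    if_true, prod_gmet]
  rw [Finset.sum_eq_single lam]
  · refine Finset.sum_congr rfl fun r _ => ?_
    rw [Finset.sum_eq_single mu]
    · simp; ring
    · intro b _ hb; simp [hb]
    · simp
  · intro b _ hb; simp [hb]
  · simp

/-- Transformation of a covariant tensor. -/
def tr (n k : ℕ) (L : Fin n → Fin n → ℝ) (S : (Fin k → Fin n) → ℝ) : (Fin k → Fin n) → ℝ :=
  fun ρ => ∑ α : Fin k → Fin n, S α * ∏ i, L (ρ i) (α i)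

lemma prod_sum_fun (n k : ℕ) (f : Fin k → Fin n → ℝ) :
    ∏ i, ∑ a, f i a = ∑ r : Fin k → Fin n, ∏ i, f i (r i) := by
  rw [Finset.prod_univ_sum, Fintype.piFinset_univ]

lemma tr_inner (n k : ℕ) (L : Fin n → Fin n → ℝ)
    (hL : ∀ a b, ∑ m, eps n m * (L m a * L m b) = gmet n a b)
    (f g : (Fin k → Fin n) → ℝ) :
    ∑ r, wt n k r * (tr n k L f r * tr n k L g r) = ∑ r, wt n k r * (f r * g r) := by
  have h1 : ∀ r, wt n k r * (tr n k L f r * tr n k L g r)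
      = ∑ α, ∑ β, f α * g β * ∏ i, (eps n (r i) * (L (r i) (α i) * L (r i) (β i))) := by
    intro r
    unfold tr wt
    rw [Finset.sum_mul_sum, Finset.mul_sum]
    refine Finset.sum_congr rfl fun α _ => ?_
    rw [Finset.mul_sum]
    refine Finset.sum_congr rfl fun β _ => ?_
    simp only [Finset.prod_mul_distrib]
    ring
  simp only [h1]
  rw [Finset.sum_comm]
  refine Finset.sum_congr rfl fun α _ => ?_
  rw [Finset.sum_comm]
  have h2 : ∀ β : Fin k → Fin n, ∑ r : Fin k → Fin n, f α * g β *
      ∏ i, (eps n (r i) * (L (r i) (α i) * L (r i) (β i)))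
      = f α * g β * (if α = β then wt n k α else 0) := by
    intro β
    rw [← Finset.mul_sum, ← prod_gmet, ← prod_sum_fun n k
      (fun i a => eps n a * (L a (α i) * L a (β i)))]
    simp only [hL]
  simp only [h2, mul_ite, mul_zero, Finset.sum_ite_eq, Finset.mem_univ, if_true]
  ring

lemma tr_cons (n k : ℕ) (L : Fin n → Fin n → ℝ) (S : (Fin (k+1) → Fin n) → ℝ)
    (lam : Fin n) (r : Fin k → Fin n) :
    tr n (k+1) L S (Fin.cons lam r)
      = ∑ a, L lam a * tr n k L (fun s => S (Fin.cons a s)) r := by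
  unfold tr
  rw [sum_cons]
  refine Finset.sum_congr rfl fun a _ => ?_
  rw [Finset.mul_sum]
  refine Finset.sum_congr rfl fun s _ => ?_
  simp only [Fin.prod_univ_succ, Fin.cons_zero, Fin.cons_succ]
  ring

lemma part_tr (n k : ℕ) (hp : 0 < k + 1) (L : Fin n → Fin n → ℝ)
    (hL : ∀ a b, ∑ m, eps n m * (L m a * L m b) = gmet n a b)
    (S : (Fin (k+1) → Fin n) → ℝ) (lam mu : Fin n) :
    partContract n (k+1) hp (tr n (k+1) L S) lam mu
      = ∑ a, ∑ b, L lam a * L mu b * partContract n (k+1) hp S a b := by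
  simp only [part_eq]
  simp only [← tr_inner n k L hL (fun s => S (Fin.cons _ s)) (fun s => S (Fin.cons _ s))]
  have h1 : ∀ r : Fin k → Fin n,
      wt n k r * (tr n (k+1) L S (Fin.cons lam r) * tr n (k+1) L S (Fin.cons mu r))
      = ∑ a, ∑ b, L lam a * L mu b * (wt n k r * (tr n k L (fun s => S (Fin.cons a s)) r
          * tr n k L (fun s => S (Fin.cons b s)) r)) := by
    intro r
    rw [tr_cons, tr_cons, Finset.sum_mul_sum, Finset.mul_sum]
    refine Finset.sum_congr rfl fun a _ => ?_
    rw [Finset.mul_sum]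
    exact Finset.sum_congr rfl fun b _ => by ring
  simp only [h1, Finset.mul_sum]
  rw [Finset.sum_comm]
  refine Finset.sum_congr rfl fun a _ => ?_
  rw [Finset.sum_comm]

lemma seT_tr (n k : ℕ) (hp : 0 < k + 1) (L : Fin n → Fin n → ℝ)
    (hL : ∀ a b, ∑ m, eps n m * (L m a * L m b) = gmet n a b)
    (hL' : ∀ a b, ∑ m, eps n m * (L a m * L b m) = gmet n a b)
    (S : (Fin (k+1) → Fin n) → ℝ) (lam mu : Fin n) :
    seT n (k+1) hp (tr n (k+1) L S) lam mu
      = ∑ a, ∑ b, L lam a * L mu b * seT n (k+1) hp S a b := by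
  unfold seT
  rw [part_tr n k hp L hL, full_eq, tr_inner n (k+1) L hL, ← full_eq, ← hL' lam mu]
  simp only [mul_sub, Finset.sum_sub_distrib]
  congr 1
  · simp only [Finset.mul_sum]
    refine Finset.sum_congr rfl fun a _ => ?_
    refine Finset.sum_congr rfl fun b _ => ?_
    ring
  · simp only [gmet_eq, mul_ite, ite_mul, mul_zero, zero_mul, Finset.sum_ite_eq, Finset.mem_univ,
      if_true]
    rw [Finset.mul_sum, Finset.sum_mul]
    refine Finset.sum_congr rfl fun a _ => ?_
    ring

lemma tr_form (n k : ℕ) (L : Fin n → Fin n → ℝ) (S : (Fin k → Fin n) → ℝ)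
    (hS : IsPForm n k S) : IsPForm n k (tr n k L S) := by
  intro σ μ
  unfold tr
  rw [← Fintype.sum_equiv (Equiv.arrowCongr σ.symm (Equiv.refl (Fin n)))
    (fun β => S (β ∘ σ) * ∏ i, L ((μ ∘ σ) i) ((β ∘ σ) i)) _ (fun β => by rfl), Finset.mul_sum]
  refine Finset.sum_congr rfl fun β _ => ?_
  rw [hS σ β, mul_assoc]
  congr 2
  exact Equiv.prod_comp σ (fun i => L (μ i) (β i))

lemma tr_tr (n k : ℕ) (L : Fin n → Fin n → ℝ) (S : (Fin k → Fin n) → ℝ)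
    (hL : ∀ a b, ∑ m, L a m * L m b = if a = b then 1 else 0) :
    tr n k L (tr n k L S) = S := by
  funext ρ
  unfold tr
  simp only [Finset.sum_mul]
  rw [Finset.sum_comm]
  have h2 : ∀ β : Fin k → Fin n, ∑ α : Fin k → Fin n,
      S β * (∏ i, L (α i) (β i)) * ∏ i, L (ρ i) (α i) = if ρ = β then S β else 0 := by
    intro β
    have : ∀ α : Fin k → Fin n, S β * (∏ i, L (α i) (β i)) * ∏ i, L (ρ i) (α i)
        = S β * ∏ i, (L (ρ i) (α i) * L (α i) (β i)) := by
      intro α; rw [Finset.prod_mul_distrib]; ring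
    simp only [this]
    rw [← Finset.mul_sum, ← prod_sum_fun n k (fun i a => L (ρ i) a * L a (β i))]
    simp only [hL]
    split_ifs with h
    · subst h; simp
    · obtain ⟨i, hi⟩ := Function.ne_iff.1 h
      rw [Finset.prod_eq_zero (Finset.mem_univ i) (by simp [hi]), mul_zero]
  simp only [h2, Finset.sum_ite_eq, Finset.mem_univ, if_true]

/-- Reflection. -/
def refl' (n : ℕ) (c : ℝ) (a : Fin n → ℝ) (m b : Fin n) : ℝ :=
  (if m = b then 1 else 0) - c * (eps n m * a m) * a b

lemma refl_one (n : ℕ) (c : ℝ) (v : Fin n → ℝ)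
    (hc : c * c * ∑ m, eps n m * (v m * v m) = 2 * c) (a b : Fin n) :
    ∑ m, eps n m * (refl' n c v m a * refl' n c v m b) = gmet n a b := by
  have h : ∀ m, eps n m * (refl' n c v m a * refl' n c v m b)
      = (if m = a then (if m = b then eps n m else 0) else 0)
        - (if m = a then c * v m * v b else 0) - (if m = b then c * v m * v a else 0)
        + c * c * v a * v b * (eps n m * (v m * v m)) := by
    intro m
    have := eps_sq n m
    unfold refl'
    split_ifs
    · linear_combination (-c * v m * v b - c * v m * v a + c*c*v a * v b * v m * v m * eps n m) * this
    · linear_combination (-c * v m * v b  + c*c*v a * v b * v m * v m * eps n m) * this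
    · linear_combination (- c * v m * v a + c*c*v a * v b * v m * v m * eps n m) * this
    · linear_combination (c*c*v a * v b * v m * v m * eps n m) * this
  simp only [h, Finset.sum_add_distrib, Finset.sum_sub_distrib, ← Finset.mul_sum,
    Finset.sum_ite_eq', Finset.mem_univ, if_true, gmet_eq]
  linear_combination v a * v b * hc

lemma refl_two (n : ℕ) (c : ℝ) (v : Fin n → ℝ)
    (hc : c * c * ∑ m, eps n m * (v m * v m) = 2 * c) (a b : Fin n) :
    ∑ m, eps n m * (refl' n c v a m * refl' n c v b m) = gmet n a b := by
  have h : ∀ m, eps n m * (refl' n c v a m * refl' n c v b m)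
      = (if a = m then (if b = m then eps n m else 0) else 0)
        - (if a = m then c * eps n m * v m * v b * eps n b else 0)
        - (if b = m then c * eps n m * v m * v a * eps n a else 0)
        + c * c * v a * v b * eps n a * eps n b * (eps n m * (v m * v m)) := by
    intro m
    unfold refl'
    split_ifs <;> ring
  simp only [h, Finset.sum_add_distrib, Finset.sum_sub_distrib, ← Finset.mul_sum,
    Finset.sum_ite_eq, Finset.mem_univ, if_true, gmet_eq]
  have : (if b = a then eps n a else 0) = (if a = b then eps n a else 0) := by
    simp only [eq_comm]
  rw [this]
  linear_combination v a * v b * eps n a * eps n b * hc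

lemma refl_inv (n : ℕ) (c : ℝ) (v : Fin n → ℝ)
    (hc : c * c * ∑ m, eps n m * (v m * v m) = 2 * c) (a b : Fin n) :
    ∑ m, refl' n c v a m * refl' n c v m b = if a = b then 1 else 0 := by
  have h : ∀ m, refl' n c v a m * refl' n c v m b
      = (if a = m then (if m = b then 1 else 0) else 0)
        - (if a = m then c * eps n m * v m * v b else 0)
        - (if m = b then c * v m * v a * eps n a else 0)
        + c * c * v a * v b * eps n a * (eps n m * (v m * v m)) := by
    intro m
    unfold refl'
    split_ifs <;> ring
  simp only [h, Finset.sum_add_distrib, Finset.sum_sub_distrib, ← Finset.mul_sum,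
    Finset.sum_ite_eq, Finset.sum_ite_eq', Finset.mem_univ, if_true]
  linear_combination v a * v b * eps n a * hc

lemma form_zero (n k : ℕ) (S : (Fin k → Fin n) → ℝ) (hS : IsPForm n k S)
    (ρ : Fin k → Fin n) (h : ¬ Function.Injective ρ) : S ρ = 0 := by
  simp only [Function.Injective, not_forall] at h
  obtain ⟨i, j, hij, hne⟩ := h
  have h1 := hS (Equiv.swap i j) ρ
  have h2 : ρ ∘ (Equiv.swap i j) = ρ := by
    funext x
    simp only [Function.comp]
    by_cases hx : x = i
    · subst hx; simp [hij]
    · by_cases hy : x = j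
      · subst hy; simp [hij]
      · rw [Equiv.swap_apply_of_ne_of_ne hx hy]
  rw [h2, Equiv.Perm.sign_swap hne] at h1
  simp at h1
  linarith

lemma count (n k : ℕ) (f : (Fin (k+1) → Fin n) → ℝ)
    (hsym : ∀ (σ : Equiv.Perm (Fin (k+1))) ρ, f (ρ ∘ σ) = f ρ)
    (hinj : ∀ ρ, ¬ Function.Injective ρ → f ρ = 0) (j : Fin n) :
    ((k : ℝ) + 1) * ∑ r : Fin k → Fin n, f (Fin.cons j r)
      = ∑ ρ, if (∃ i, ρ i = j) then f ρ else 0 := by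
  have h1 : ∀ i : Fin (k+1), ∑ ρ : Fin (k+1) → Fin n, (if ρ i = j then f ρ else 0)
      = ∑ r : Fin k → Fin n, f (Fin.cons j r) := by
    intro i
    have h2 : ∑ ρ : Fin (k+1) → Fin n, (if ρ i = j then f ρ else 0)
        = ∑ ρ : Fin (k+1) → Fin n, (if ρ 0 = j then f ρ else 0) := by
      refine Fintype.sum_equiv (Equiv.arrowCongr (Equiv.swap 0 i) (Equiv.refl (Fin n))) _ _ ?_
      intro ρ
      have : (Equiv.arrowCongr (Equiv.swap 0 i) (Equiv.refl (Fin n))) ρ = ρ ∘ (Equiv.swap 0 i) := by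
        funext x; simp
      rw [this, hsym]
      simp
    rw [h2, sum_cons, Finset.sum_eq_single j]
    · simp
    · intro b _ hb; simp [hb]
    · simp
  have h3 : ((k : ℝ) + 1) * ∑ r : Fin k → Fin n, f (Fin.cons j r)
      = ∑ i : Fin (k+1), ∑ ρ : Fin (k+1) → Fin n, (if ρ i = j then f ρ else 0) := by
    simp only [h1]; simp
  rw [h3, Finset.sum_comm]
  refine Finset.sum_congr rfl fun ρ _ => ?_
  by_cases hi : Function.Injective ρ
  · split_ifs with h
    · obtain ⟨i, rfl⟩ := h
      rw [Finset.sum_eq_single i]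
      · simp
      · intro b _ hb
        rw [if_neg (fun h => hb (hi h))]
      · simp
    · push Not at h
      simp [h]
  · simp [hinj ρ hi]

lemma wt_one (n k : ℕ) (z : Fin n) (hz : (z : ℕ) = 0) (r : Fin k → Fin n)
    (h : ∀ i, r i ≠ z) : wt n k r = 1 := by
  unfold wt eps
  refine Finset.prod_eq_one fun i _ => ?_
  rw [if_neg]
  intro h0
  exact h i (Fin.ext (h0.trans hz.symm))

lemma wt_neg (n k : ℕ) (z : Fin n) (hz : (z : ℕ) = 0) (r : Fin k → Fin n)
    (hr : Function.Injective r) (h : ∃ i, r i = z) : wt n k r = -1 := by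
  obtain ⟨i, hi⟩ := h
  unfold wt
  rw [Finset.prod_eq_single i]
  · simp [eps, hi, hz]
  · intro b _ hb
    unfold eps
    rw [if_neg]
    intro h0
    exact hb (hr ((Fin.ext (h0.trans hz.symm)).trans hi.symm))
  · simp

lemma cons_noz (n k : ℕ) (S : (Fin (k+1) → Fin n) → ℝ) (hS : IsPForm n (k+1) S)
    (z : Fin n) (r : Fin k → Fin n) (h : S (Fin.cons z r) ≠ 0) : ∀ i, r i ≠ z := by
  intro i hi
  apply h
  apply form_zero n (k+1) S hS
  intro hinj
  have := @hinj 0 i.succ (by simp [hi])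
  exact (Fin.succ_ne_zero i) this.symm

lemma base (n k : ℕ) (hp : 0 < k + 1) (S : (Fin (k+1) → Fin n) → ℝ) (hS : IsPForm n (k+1) S)
    (z : Fin n) (hz : (z : ℕ) = 0) :
    (S ≠ 0 → 0 < seT n (k+1) hp S z z) ∧
    ∀ j, j ≠ z → |seT n (k+1) hp S j z| ≤ seT n (k+1) hp S z z := by
  classical
  set f : (Fin (k+1) → Fin n) → ℝ := fun ρ => S ρ * S ρ with hf
  set g : (Fin (k+1) → Fin n) → ℝ := fun ρ => if (∃ i, ρ i = z) then 0 else S ρ * S ρ with hg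
  have fsym : ∀ (σ : Equiv.Perm (Fin (k+1))) ρ, f (ρ ∘ σ) = f ρ := by
    intro σ ρ
    simp only [hf]
    rw [hS σ ρ]
    rcases Int.units_eq_one_or (Equiv.Perm.sign σ) with h | h <;> simp [h]
  have finj : ∀ ρ, ¬ Function.Injective ρ → f ρ = 0 := fun ρ h => by
    simp [hf, form_zero n (k+1) S hS ρ h]
  have gsym : ∀ (σ : Equiv.Perm (Fin (k+1))) ρ, g (ρ ∘ σ) = g ρ := by
    intro σ ρ
    have h1 := fsym σ ρ
    simp only [hf] at h1
    simp only [hg, h1]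
    have : (∃ i, (ρ ∘ σ) i = z) ↔ ∃ i, ρ i = z :=
      ⟨fun ⟨i, hi⟩ => ⟨σ i, hi⟩, fun ⟨i, hi⟩ => ⟨σ.symm i, by simpa using hi⟩⟩
    simp only [this]
  have ginj : ∀ ρ, ¬ Function.Injective ρ → g ρ = 0 := fun ρ h => by
    simp [hg, form_zero n (k+1) S hS ρ h]
  have gnn : ∀ ρ, 0 ≤ g ρ := fun ρ => by
    simp only [hg]; split_ifs
    · exact le_rfl
    · exact mul_self_nonneg _
  set X := ∑ r : Fin k → Fin n, f (Fin.cons z r) with hX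
  set Y := ∑ ρ, g ρ with hY
  have cX := count n k f fsym finj z
  rw [← hX] at cX
  have hfull : fullContract n (k+1) S = -((k : ℝ)+1) * X + Y := by
    rw [full_eq, neg_mul, cX, hY, ← Finset.sum_neg_distrib, ← Finset.sum_add_distrib]
    refine Finset.sum_congr rfl fun ρ _ => ?_
    by_cases hi : Function.Injective ρ
    · by_cases h : ∃ i, ρ i = z
      · simp only [hf, hg, if_pos h, wt_neg n (k+1) z hz ρ hi h]; ring
      · simp only [hg, if_neg h]
        push Not at h
        rw [wt_one n (k+1) z hz ρ h]; ring
    · simp [hf, hg, form_zero n (k+1) S hS ρ hi]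
  have hpz : partContract n (k+1) hp S z z = X := by
    rw [part_eq, hX]
    refine Finset.sum_congr rfl fun r _ => ?_
    by_cases h : S (Fin.cons z r) = 0
    · simp [hf, h]
    · rw [wt_one n k z hz r (cons_noz n k S hS z r h), one_mul]
  have hk : (0 : ℝ) < (k.factorial : ℝ) := by exact_mod_cast k.factorial_pos
  have hk1 : (0 : ℝ) < (k : ℝ) + 1 := by positivity
  have hfac : (((k+1).factorial : ℕ) : ℝ) = ((k : ℝ) + 1) * (k.factorial : ℝ) := by
    rw [Nat.factorial_succ]; push_cast; ring
  have hT : seT n (k+1) hp S z z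
      = (1 / (2 * (((k : ℝ) + 1) * (k.factorial : ℝ)))) * (((k : ℝ) + 1) * X + Y) := by
    unfold seT
    rw [hfull, hpz, hfac]
    simp only [gmet_eq, eps, hz, if_true, Nat.add_sub_cancel]
    field_simp
    ring
  constructor
  · intro hne
    obtain ⟨ρ, hρ⟩ := Function.ne_iff.1 hne
    rw [hT]
    apply mul_pos (by positivity)
    rw [cX, hY, ← Finset.sum_add_distrib]
    have heq : ∀ ρ : Fin (k+1) → Fin n, (if (∃ i, ρ i = z) then f ρ else 0) + g ρ = S ρ * S ρ := by
      intro ρ; simp only [hf, hg]; split_ifs <;> ring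
    simp only [heq]
    refine Finset.sum_pos' (fun i _ => mul_self_nonneg _) ⟨ρ, Finset.mem_univ _, ?_⟩
    exact mul_self_pos.2 (by simpa using hρ)
  · intro j hj
    have cZ := count n k g gsym ginj j
    set Z := ∑ r : Fin k → Fin n, g (Fin.cons j r) with hZ
    have hZY : ((k : ℝ)+1) * Z ≤ Y := by
      rw [cZ, hY]
      refine Finset.sum_le_sum fun ρ _ => ?_
      split_ifs
      · exact le_rfl
      · exact gnn ρ
    have hC : |partContract n (k+1) hp S j z| ≤ (X + Z) / 2 := by
      rw [part_eq, hX, hZ, ← Finset.sum_add_distrib, Finset.sum_div]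
      refine (Finset.abs_sum_le_sum_abs _ _).trans (Finset.sum_le_sum fun r _ => ?_)
      by_cases h : S (Fin.cons z r) = 0
      · simp only [hf, h, mul_zero, abs_zero, zero_add]
        exact div_nonneg (gnn _) (by norm_num)
      · have hr := cons_noz n k S hS z r h
        have : ¬ ∃ i, (Fin.cons j r : Fin (k+1) → Fin n) i = z := by
          rintro ⟨i, hi⟩
          induction i using Fin.cases with
          | zero => exact hj (by simpa using hi)
          | succ i => exact hr i (by simpa using hi)
        simp only [hf, hg, if_neg this, wt_one n k z hz r hr, one_mul]
        rw [abs_le]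
        constructor <;> nlinarith [sq_nonneg (S (Fin.cons z r) - S (Fin.cons j r)),
          sq_nonneg (S (Fin.cons z r) + S (Fin.cons j r))]
    have hTj : seT n (k+1) hp S j z
        = (1 / (k.factorial : ℝ)) * partContract n (k+1) hp S j z := by
      unfold seT
      simp [gmet_eq, hj]
    rw [hTj, hT, abs_mul, abs_of_pos (by positivity : (0:ℝ) < 1 / (k.factorial : ℝ))]
    calc 1 / (k.factorial : ℝ) * |partContract n (k+1) hp S j z|
        ≤ 1 / (k.factorial : ℝ) * ((X + Z) / 2) := by gcongr
      _ = (1 / (2 * (((k : ℝ) + 1) * (k.factorial : ℝ)))) * (((k : ℝ) + 1) * X + ((k : ℝ)+1) * Z) := by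
        field_simp
      _ ≤ _ := by gcongr

lemma causal0 (n k : ℕ) (hp : 0 < k + 1) (S : (Fin (k+1) → Fin n) → ℝ) (hS : IsPForm n (k+1) S)
    (z : Fin n) (hz : (z : ℕ) = 0) :
    ∑ m, eps n m * (seT n (k+1) hp S m z * seT n (k+1) hp S m z) ≤ 0 := by
  classical
  set t : Fin n → ℝ := fun m => seT n (k+1) hp S m z with ht
  change ∑ m, eps n m * (t m * t m) ≤ 0
  have hez : eps n z = -1 := by simp [eps, hz]
  have hes : ∀ m, m ≠ z → eps n m = 1 := by
    intro m hm
    unfold eps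
    rw [if_neg]
    intro h0; exact hm (Fin.ext (h0.trans hz.symm))
  set q : Fin n → ℝ := fun m => if m = z then 0 else t m with hq
  set Q := ∑ m, q m * q m with hQ
  have hQ0 : 0 ≤ Q := Finset.sum_nonneg fun i _ => mul_self_nonneg _
  have hsum : ∑ m, eps n m * (t m * t m) = - (t z * t z) + Q := by
    have : ∀ m, eps n m * (t m * t m) = (if m = z then -(t m * t m) else 0) + q m * q m := by
      intro m
      by_cases h : m = z
      · subst h; simp [hq, hez]
      · simp [hq, h, hes m h]
    simp only [this, Finset.sum_add_distrib, Finset.sum_ite_eq', Finset.mem_univ, if_true, hQ]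
  rw [hsum]
  by_cases hex : ∃ j : Fin n, j ≠ z
  swap
  · push Not at hex
    have : Q = 0 := by
      rw [hQ]; exact Finset.sum_eq_zero fun m _ => by simp [hq, hex m]
    rw [this]; nlinarith [mul_self_nonneg (t z)]
  obtain ⟨j, hj⟩ := hex
  set N := Real.sqrt Q with hN
  have hNN : N * N = Q := Real.mul_self_sqrt hQ0
  set a : Fin n → ℝ := fun m => q m - (if m = j then N else 0) with ha
  have haz : a z = 0 := by simp [ha, hq, Ne.symm hj]
  have hqj : q j = t j := by simp [hq, hj]
  have haj : a j = t j - N := by simp [ha, hqj]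
  have hat : ∑ m, a m * t m = Q - N * t j := by
    have : ∀ m, a m * t m = q m * q m - (if m = j then N * t m else 0) := by
      intro m
      by_cases h : m = z
      · subst h; simp [haz, hq, Ne.symm hj]
      · simp only [ha, hq, if_neg h]; split_ifs <;> ring
    simp only [this, Finset.sum_sub_distrib, Finset.sum_ite_eq', Finset.mem_univ, if_true, hQ]
  have haa : ∑ m, eps n m * (a m * a m) = 2 * (Q - N * t j) := by
    have : ∀ m, eps n m * (a m * a m)
        = q m * q m + (if m = j then N * N - 2 * N * q m else 0) := by
      intro m
      by_cases h : m = z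
      · subst h; simp [haz, hq, Ne.symm hj]
      · rw [hes m h]; simp only [ha]; split_ifs <;> ring
    simp only [this, Finset.sum_add_distrib, Finset.sum_ite_eq', Finset.mem_univ, if_true]
    rw [← hQ, hNN, hqj]; ring
  set c : ℝ := (Q - N * t j)⁻¹ with hc
  have hcc : c * c * ∑ m, eps n m * (a m * a m) = 2 * c := by
    rw [haa]
    by_cases h0 : Q - N * t j = 0
    · simp [hc, h0]
    · rw [hc]; field_simp
  set L := refl' n c a with hL
  have hLz : ∀ b, L z b = if z = b then 1 else 0 := by
    intro b; simp [hL, refl', haz]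
  have htr : ∀ m, seT n (k+1) hp (tr n (k+1) L S) m z = t m - c * (eps n m * a m) * (Q - N * t j) := by
    intro m
    rw [seT_tr n k hp L (refl_one n c a hcc) (refl_two n c a hcc)]
    simp only [hLz, mul_ite, ite_mul, mul_one, mul_zero, zero_mul, Finset.sum_ite_eq,
      Finset.mem_univ, if_true]
    change ∑ x, L m x * t x = _
    simp only [hL, refl', sub_mul, Finset.sum_sub_distrib, ite_mul, one_mul, zero_mul,
      Finset.sum_ite_eq, Finset.mem_univ, if_true]
    rw [← hat, Finset.mul_sum]
    congr 1
    exact Finset.sum_congr rfl fun x _ => by ring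
  have hb := (base n k hp (tr n (k+1) L S) (tr_form n (k+1) L S hS) z hz).2 j hj
  rw [htr, htr, haz, hes j hj, haj] at hb
  have hfin : t j - c * (1 * (t j - N)) * (Q - N * t j) = N := by
    by_cases h0 : Q - N * t j = 0
    · rw [h0, mul_zero, sub_zero]
      rw [h0, mul_zero] at haa
      have hall : ∀ m, 0 ≤ eps n m * (a m * a m) := by
        intro m
        by_cases h : m = z
        · subst h; simp [haz]
        · rw [hes m h, one_mul]; exact mul_self_nonneg _
      have := (Finset.sum_eq_zero_iff_of_nonneg (fun m _ => hall m)).1 haa j (Finset.mem_univ _)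
      rw [hes j hj, one_mul, haj] at this
      have := mul_self_eq_zero.1 this
      linarith
    · have hi : c * (Q - N * t j) = 1 := inv_mul_cancel₀ h0
      linear_combination (N - t j) * hi
  rw [hfin] at hb
  simp only [mul_zero, zero_mul, sub_zero] at hb
  have h1 := abs_le.1 hb
  have hN0 : 0 ≤ N := Real.sqrt_nonneg _
  rw [abs_of_nonneg hN0] at hb
  nlinarith

lemma sum_gmet (n : ℕ) (v w : Fin n → ℝ) :
    ∑ μ : Fin n, ∑ ν : Fin n, gmet n μ ν * v μ * w ν = ∑ m, eps n m * (v m * w m) := by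
  simp only [gmet_eq, ite_mul, zero_mul, Finset.sum_ite_eq, Finset.mem_univ, if_true]
  exact Finset.sum_congr rfl fun m _ => by ring

/-- the super-energy flux vector is causal, and if `Σ ≠ 0` it is
future-pointing (same time orientation as `u`). -/
theorem seFlux_causal_future
    (n p : ℕ) (hp : 1 ≤ p) (hpn : p ≤ n)
    (S : (Fin p → Fin n) → ℝ) (hS : IsPForm n p S)
    (u : Fin n → ℝ) (hu : minkSq n u = -1) (huf : 0 < u ⟨0, by omega⟩) :
    minkSq n (seFlux n p hp S u) ≤ 0 ∧
      (S ≠ 0 →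
        (∑ μ : Fin n, ∑ ν : Fin n, gmet n μ ν * seFlux n p hp S u μ * u ν) < 0) := by
  obtain ⟨k, rfl⟩ : ∃ k, p = k + 1 := ⟨p - 1, by omega⟩
  have hn : 0 < n := by omega
  obtain ⟨z, hzdef⟩ : ∃ z : Fin n, z = ⟨0, hn⟩ := ⟨_, rfl⟩
  have hz : (z : ℕ) = 0 := by rw [hzdef]
  have hu0 : 0 < u z := by rw [hzdef]; exact huf
  unfold minkSq at hu ⊢
  rw [sum_gmet] at hu ⊢
  rw [sum_gmet]
  have hez : eps n z = -1 := by simp [eps, hz]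
  set F : Fin n → ℝ := fun m => ∑ b, seT n (k+1) hp S m b * u b with hF
  have hP : ∀ m, seFlux n (k+1) hp S u m = - (eps n m * F m) := by
    intro m
    unfold seFlux
    simp only [gmet_eq, ite_mul, zero_mul, hF]
    rw [Finset.sum_comm]
    simp only [Finset.sum_ite_eq, Finset.mem_univ, if_true, Finset.mul_sum, mul_assoc]
  set a : Fin n → ℝ := fun m => u m + (if m = z then 1 else 0) with ha
  set c : ℝ := - (1 + u z)⁻¹ with hc
  have h1u : (1 + u z) ≠ 0 := by positivity
  have haa : ∑ m, eps n m * (a m * a m) = - 2 * (1 + u z) := by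
    have : ∀ m, eps n m * (a m * a m)
        = eps n m * (u m * u m) + (if m = z then eps n m * (2 * u m + 1) else 0) := by
      intro m; simp only [ha]; split_ifs <;> ring
    simp only [this, Finset.sum_add_distrib, Finset.sum_ite_eq', Finset.mem_univ, if_true, hu, hez]
    ring
  have hcc : c * c * ∑ m, eps n m * (a m * a m) = 2 * c := by
    rw [haa, hc]; field_simp
  set L := refl' n c a with hL
  have hLz : ∀ b, L z b = - u b := by
    intro b
    have haz : a z = u z + 1 := by simp [ha]
    simp only [hL, refl', hez, haz, hc]
    have : -(1 + u z)⁻¹ * (-1 * (u z + 1)) = 1 := by field_simp; ring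
    rw [this]
    simp only [ha, eq_comm]
    split_ifs <;> ring
  have htr : ∀ m, seT n (k+1) hp (tr n (k+1) L S) m z = - ∑ x, L m x * F x := by
    intro m
    rw [seT_tr n k hp L (refl_one n c a hcc) (refl_two n c a hcc), ← Finset.sum_neg_distrib]
    refine Finset.sum_congr rfl fun x _ => ?_
    simp only [hF, hLz, Finset.mul_sum]
    rw [← Finset.sum_neg_distrib]
    exact Finset.sum_congr rfl fun b _ => by ring
  have hform := tr_form n (k+1) L S hS
  constructor
  · have h := causal0 n k hp _ hform z hz
    simp only [htr] at h
    have hq : ∑ m, eps n m * ((- ∑ x, L m x * F x) * (- ∑ x, L m x * F x))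
        = ∑ m, eps n m * (F m * F m) := by
      have h1 : ∀ m, eps n m * ((- ∑ x, L m x * F x) * (- ∑ x, L m x * F x))
          = ∑ x, ∑ y, F x * F y * (eps n m * (L m x * L m y)) := by
        intro m
        rw [neg_mul_neg, Finset.sum_mul_sum, Finset.mul_sum]
        refine Finset.sum_congr rfl fun x _ => ?_
        rw [Finset.mul_sum]
        exact Finset.sum_congr rfl fun y _ => by ring
      simp only [h1]
      rw [Finset.sum_comm]
      refine Finset.sum_congr rfl fun x _ => ?_
      rw [Finset.sum_comm]
      simp only [← Finset.mul_sum, hL, refl_one n c a hcc]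
      simp only [gmet_eq, mul_ite, mul_zero, Finset.sum_ite_eq, Finset.mem_univ, if_true]
      ring
    rw [hq] at h
    refine le_of_eq_of_le (Finset.sum_congr rfl fun m _ => ?_) h
    rw [hP]
    linear_combination (eps n m * F m * F m) * eps_sq n m
  · intro hne
    have hne' : tr n (k+1) L S ≠ 0 := by
      intro h0
      apply hne
      rw [← tr_tr n (k+1) L S (refl_inv n c a hcc), h0]
      funext ρ; simp [tr]
    have h := (base n k hp _ hform z hz).1 hne'
    rw [htr] at h
    simp only [hLz, neg_mul, Finset.sum_neg_distrib, neg_neg] at h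
    have : ∑ m, eps n m * (seFlux n (k+1) hp S u m * u m) = - ∑ x, u x * F x := by
      rw [← Finset.sum_neg_distrib]
      refine Finset.sum_congr rfl fun m _ => ?_
      rw [hP]
      linear_combination (- F m * u m) * eps_sq n m
    rw [this]
    linarith
end
end

section
/- Let s ≥ 1 and let T : (ℝⁿ)^s → ℝ be an s-linear map satisfying the dominant super-energy property: T(k₁,…,k_s) ≥ 0 whenever every k_i is a future-pointing causal vector. Let e : Fin n → ℝⁿ be an orthonormal basis, i.e. η_{μν} e_a^μ e_b^ν = η_{ab} for all a, b ∈ Fin n, with e₀ future-pointing. Then the completely timelike component dominates all components: T(e₀, …, e₀) ≥ |T(e_{a₁}, …, e_{a_s})| for every choice of indices a₁, …, a_s ∈ Fin n. -/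
open Finset

noncomputable section

theorem mink_dom_aux {V : Type*} [AddCommGroup V] [Module ℝ V] (C : V → Prop) :
    ∀ (s : ℕ) (T : MultilinearMap ℝ (fun _ : Fin s => V) ℝ)
      (_ : ∀ k : Fin s → V, (∀ i, C (k i)) → 0 ≤ T k) (u : V) (x : Fin s → V)
      (_ : ∀ i, C (u + x i) ∧ C (u - x i)),
      |T x| ≤ T (fun _ => u) := by
  intro s
  induction s with
  | zero =>
    intro T hT u x hx
    have h1 : x = fun _ => u := Subsingleton.elim _ _
    rw [h1, abs_of_nonneg]
    exact hT _ (fun i => i.elim0)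
  | succ s ih =>
    intro T hT u x hx
    have key : ∀ w, C w → |T (Fin.cons w (Fin.tail x))| ≤ T (Fin.cons w (fun _ => u)) := by
      intro w hw
      have := ih (T.curryLeft w) (by
        intro k hk
        rw [MultilinearMap.curryLeft_apply]
        apply hT
        intro i
        refine Fin.cases ?_ (fun j => ?_) i
        · simpa using hw
        · simpa using hk j) u (Fin.tail x) (fun i => hx i.succ)
      simpa using this
    have hp := key _ (hx 0).1
    have hm := key _ (hx 0).2
    have hsub : ∀ (y : Fin s → V), T (Fin.cons (u - x 0) y)
        = T (Fin.cons u y) - T (Fin.cons (x 0) y) := by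
      intro y
      have h2 := T.cons_add y (u - x 0) (x 0)
      rw [sub_add_cancel] at h2
      linarith
    have hadd : ∀ (y : Fin s → V), T (Fin.cons (u + x 0) y)
        = T (Fin.cons u y) + T (Fin.cons (x 0) y) := by
      intro y
      exact T.cons_add y u (x 0)
    rw [hadd, hadd] at hp
    rw [hsub, hsub] at hm
    have h1 : Fin.cons (x 0) (Fin.tail x) = x := Fin.cons_self_tail x
    have h2 : (Fin.cons u (fun _ => u) : Fin (s+1) → V) = fun _ => u := by
      funext i
      refine Fin.cases ?_ (fun j => ?_) i <;> simp
    rw [h1, h2] at hp hm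
    rw [abs_le] at hp hm ⊢
    constructor <;> linarith [hp.1, hp.2, hm.1, hm.2]

theorem mink_form_eq (m : ℕ) (v w : Fin (m+1) → ℝ) :
    (∑ μ, ∑ ν, gmet (m+1) μ ν * v μ * w ν)
      = - (v 0 * w 0) + ∑ i : Fin m, v i.succ * w i.succ := by
  have : ∀ μ, ∑ ν, gmet (m+1) μ ν * v μ * w ν
      = (if (μ : ℕ) = 0 then -1 else 1) * v μ * w μ := by
    intro μ
    simp [gmet, ite_mul]
  simp only [this, Fin.sum_univ_succ]
  simp

/-- if an `s`-linear map satisfies the dominant super-energy property, then in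
any orthonormal basis with future-pointing `e₀` the completely timelike component dominates
the absolute value of every component. -/
theorem timelike_component_dominates
    (n s : ℕ) (hs : 1 ≤ s) (hn : 0 < n)
    (T : MultilinearMap ℝ (fun _ : Fin s => (Fin n → ℝ)) ℝ)
    (hT : ∀ k : Fin s → (Fin n → ℝ),
      (∀ i, minkSq n (k i) ≤ 0 ∧ 0 < k i ⟨0, hn⟩) → 0 ≤ T k)
    (e : Fin n → Fin n → ℝ)
    (hON : ∀ a b : Fin n,
      (∑ μ : Fin n, ∑ ν : Fin n, gmet n μ ν * e a μ * e b ν) = gmet n a b)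
    (he0 : 0 < e ⟨0, hn⟩ ⟨0, hn⟩) :
    ∀ a : Fin s → Fin n, |T (fun i => e (a i))| ≤ T (fun _ => e ⟨0, hn⟩) := by
  obtain ⟨m, rfl⟩ : ∃ m, n = m + 1 := ⟨n - 1, by omega⟩
  have h00 : (⟨0, hn⟩ : Fin (m+1)) = 0 := rfl
  rw [h00]
  change 0 < e 0 0 at he0
  intro a
  refine mink_dom_aux (fun v => v = 0 ∨ (minkSq (m+1) v ≤ 0 ∧ 0 < v 0)) s T ?_ (e 0)
    (fun i => e (a i)) ?_
  · intro k hk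
    by_cases h : ∃ i, k i = 0
    · obtain ⟨i, hi⟩ := h
      rw [T.map_coord_zero i hi]
    · push Not at h
      exact hT k (fun i => (hk i).resolve_left (h i))
  · intro i
    simp only [mink_form_eq] at hON
    have huu := hON 0 0
    simp only [gmet, if_true, Fin.val_zero] at huu
    by_cases hb : a i = 0
    · rw [hb]
      refine ⟨Or.inr ⟨?_, ?_⟩, Or.inl (sub_self _)⟩
      · rw [minkSq, mink_form_eq]
        have : ∀ j : Fin m, (e 0 + e 0) j.succ * (e 0 + e 0) j.succ
            = 4 * (e 0 j.succ * e 0 j.succ) := by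
          intro j; simp only [Pi.add_apply]; ring
        simp only [this, ← Finset.mul_sum]
        simp only [Pi.add_apply]
        nlinarith
      · simp only [Pi.add_apply]; linarith
    · have hbv : ((a i : Fin (m+1)) : ℕ) ≠ 0 := fun h => hb (Fin.ext h)
      have hux := hON 0 (a i)
      have hxx := hON (a i) (a i)
      simp only [gmet, if_true, if_neg hbv, if_neg (Ne.symm hb)] at hux hxx
      generalize e (a i) = x at *
      generalize e 0 = u at *
      have cs := Finset.sum_mul_sq_le_sq_mul_sq Finset.univ
        (fun j : Fin m => u j.succ) (fun j => x j.succ)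
      simp only [pow_two] at cs
      have e1 : ∑ j : Fin m, u j.succ * x j.succ = u 0 * x 0 := by linarith
      have e2 : ∑ j : Fin m, u j.succ * u j.succ = u 0 * u 0 - 1 := by linarith
      have e3 : ∑ j : Fin m, x j.succ * x j.succ = 1 + x 0 * x 0 := by linarith
      rw [e1, e2, e3] at cs
      have hlt : |x 0| < u 0 := by
        apply abs_lt_of_sq_lt_sq _ he0.le
        nlinarith
      rw [abs_lt] at hlt
      refine ⟨Or.inr ⟨?_, ?_⟩, Or.inr ⟨?_, ?_⟩⟩
      · rw [minkSq, mink_form_eq]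
        have : ∀ j : Fin m, (u + x) j.succ * (u + x) j.succ
            = u j.succ * u j.succ + 2 * (u j.succ * x j.succ) + x j.succ * x j.succ := by
          intro j; simp only [Pi.add_apply]; ring
        simp only [this, Finset.sum_add_distrib, ← Finset.mul_sum, e1, e2, e3]
        simp only [Pi.add_apply]
        nlinarith
      · simp only [Pi.add_apply]; linarith
      · rw [minkSq, mink_form_eq]
        have : ∀ j : Fin m, (u - x) j.succ * (u - x) j.succ
            = u j.succ * u j.succ - 2 * (u j.succ * x j.succ) + x j.succ * x j.succ := by
          intro j; simp only [Pi.sub_apply]; ring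
        simp only [this, Finset.sum_add_distrib, Finset.sum_sub_distrib, ← Finset.mul_sum,
          e1, e2, e3]
        simp only [Pi.sub_apply]
        nlinarith
      · simp only [Pi.sub_apply]; linarith
end
end

section
/- Let 1 ≤ p ≤ n and 1 ≤ q ≤ n, let K be a double (p,q)-form on n-dimensional Minkowski space, let u be a unit timelike vector, and set h^{μν} = η^{μν} + 2u^μu^ν. Then the super-energy density of K relative to u equals the h-square of K: T{K}_{αβλμ} u^α u^β u^λ u^μ = (1/(2·p!·q!)) · K_{μ₁…μ_p,σ₁…σ_q} K_{ν₁…ν_p,τ₁…τ_q} h^{μ₁ν₁} ⋯ h^{μ_pν_p} h^{σ₁τ₁} ⋯ h^{σ_qτ_q}. -/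
open Finset

noncomputable section

/-- Components of the positive-definite metric `h^{μν} = η^{μν} + 2 u^μ u^ν`. -/
def hInv (n : ℕ) (u : Fin n → ℝ) (μ ν : Fin n) : ℝ :=
  gmet n μ ν + 2 * u μ * u ν

/-- the weight with one `u u` factor in the slot `i`. -/
def uWt (n p : ℕ) (u : Fin n → ℝ) (i : Fin p) (ρ ρ' : Fin p → Fin n) : ℝ :=
  u (ρ i) * u (ρ' i) * ∏ k ∈ Finset.univ.filter (fun k => k ≠ i), gmet n (ρ k) (ρ' k)

theorem sum_swap_slot {n p : ℕ} (i j : Fin p) (f : (Fin p → Fin n) → ℝ) :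
    ∑ ρ, f (ρ ∘ Equiv.swap i j) = ∑ ρ, f ρ :=
  Fintype.sum_equiv (Equiv.arrowCongr (Equiv.swap i j) (Equiv.refl (Fin n))) _ _ (fun ρ => by
    congr 1)

theorem vanish_two {n p : ℕ} (u : Fin n → ℝ) (A : (Fin p → Fin n) → ℝ)
    (hA : ∀ (i j : Fin p), i ≠ j → ∀ ρ, A (ρ ∘ Equiv.swap i j) = - A ρ)
    (ρ' : Fin p → Fin n) (t : Finset (Fin p)) (i j : Fin p) (hi : i ∈ t) (hj : j ∈ t)
    (hij : i ≠ j) :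
    ∑ ρ, A ρ * ((∏ k ∈ t, 2 * u (ρ k) * u (ρ' k)) *
      ∏ k ∈ Finset.univ \ t, gmet n (ρ k) (ρ' k)) = 0 := by
  have h := sum_swap_slot i j (fun ρ => A ρ * ((∏ k ∈ t, 2 * u (ρ k) * u (ρ' k)) *
      ∏ k ∈ Finset.univ \ t, gmet n (ρ k) (ρ' k)))
  have h2 : ∀ ρ : Fin p → Fin n, A (ρ ∘ Equiv.swap i j) *
      ((∏ k ∈ t, 2 * u ((ρ ∘ Equiv.swap i j) k) * u (ρ' k)) *
      ∏ k ∈ Finset.univ \ t, gmet n ((ρ ∘ Equiv.swap i j) k) (ρ' k))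
      = - (A ρ * ((∏ k ∈ t, 2 * u (ρ k) * u (ρ' k)) *
      ∏ k ∈ Finset.univ \ t, gmet n (ρ k) (ρ' k))) := by
    intro ρ
    rw [hA i j hij]
    have e1 : ∏ k ∈ t, 2 * u ((ρ ∘ Equiv.swap i j) k) * u (ρ' k)
        = ∏ k ∈ t, 2 * u (ρ k) * u (ρ' k) := by
      simp only [Finset.prod_mul_distrib]
      congr 2
      refine Finset.prod_equiv (Equiv.swap i j) ?_ ?_
      · intro k
        by_cases h1 : k = i
        · subst h1; simp [hi, hj]
        · by_cases h2 : k = j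
          · subst h2; simp [hi, hj]
          · rw [Equiv.swap_apply_of_ne_of_ne h1 h2]
      · intro k _; rfl
    have e2 : ∏ k ∈ Finset.univ \ t, gmet n ((ρ ∘ Equiv.swap i j) k) (ρ' k)
        = ∏ k ∈ Finset.univ \ t, gmet n (ρ k) (ρ' k) := by
      refine Finset.prod_congr rfl ?_
      intro k hk
      have hk' : k ∉ t := by simpa using hk
      have h1 : k ≠ i := fun h => hk' (h ▸ hi)
      have h2 : k ≠ j := fun h => hk' (h ▸ hj)
      simp [Equiv.swap_apply_of_ne_of_ne h1 h2]
    rw [e1, e2]; ring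
  simp only [h2, Finset.sum_neg_distrib] at h
  linarith

theorem sum_finset_small {p : ℕ} (X : Finset (Fin p) → ℝ)
    (h : ∀ t i j, i ∈ t → j ∈ t → i ≠ j → X t = 0) :
    ∑ t ∈ (Finset.univ : Finset (Fin p)).powerset, X t = X ∅ + ∑ i, X {i} := by
  classical
  have h1 : ∑ i, X {i} = ∑ t ∈ Finset.univ.image (fun i : Fin p => ({i} : Finset (Fin p))), X t := by
    rw [Finset.sum_image]
    intro a _ b _ hab
    simpa using hab
  rw [h1, ← Finset.sum_insert (by simp)]
  symm
  refine Finset.sum_subset (by simp) ?_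
  intro t _ ht
  by_contra hX
  apply ht
  rcases t.eq_empty_or_nonempty with rfl | ⟨i, hi⟩
  · simp
  · refine Finset.mem_insert_of_mem (Finset.mem_image.2 ⟨i, Finset.mem_univ _, ?_⟩)
    refine (Finset.eq_singleton_iff_unique_mem.2 ⟨hi, fun j hj => ?_⟩).symm
    by_contra hne
    exact hX (h t j i hj hi hne)

theorem uWt_swap {n p : ℕ} (u : Fin n → ℝ) (i j : Fin p) (ρ ρ' : Fin p → Fin n) :
    uWt n p u i (ρ ∘ Equiv.swap i j) (ρ' ∘ Equiv.swap i j) = uWt n p u j ρ ρ' := by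
  unfold uWt
  simp only [Function.comp, Equiv.swap_apply_left]
  congr 1
  refine Finset.prod_equiv (Equiv.swap i j) ?_ (fun _ _ => rfl)
  intro k
  simp only [Finset.mem_filter, Finset.mem_univ, true_and]
  rw [not_iff_not, Equiv.swap_apply_eq_iff, Equiv.swap_apply_right]

theorem block_expand {n p : ℕ} (hp : 0 < p) (u : Fin n → ℝ)
    (F : (Fin p → Fin n) → (Fin p → Fin n) → ℝ)
    (h1 : ∀ (i j : Fin p), i ≠ j → ∀ ρ ρ', F (ρ ∘ Equiv.swap i j) ρ' = - F ρ ρ')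
    (h2 : ∀ (i j : Fin p), i ≠ j → ∀ ρ ρ', F ρ (ρ' ∘ Equiv.swap i j) = - F ρ ρ') :
    ∑ ρ', ∑ ρ, F ρ ρ' * ∏ i, hInv n u (ρ i) (ρ' i)
      = (∑ ρ', ∑ ρ, F ρ ρ' * ∏ i, gmet n (ρ i) (ρ' i))
        + 2 * p * ∑ ρ', ∑ ρ, F ρ ρ' * uWt n p u ⟨0, hp⟩ ρ ρ' := by
  have key : ∀ ρ', ∑ ρ, F ρ ρ' * ∏ i, hInv n u (ρ i) (ρ' i)
      = (∑ ρ, F ρ ρ' * ∏ i, gmet n (ρ i) (ρ' i))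
        + ∑ i, 2 * ∑ ρ, F ρ ρ' * uWt n p u i ρ ρ' := by
    intro ρ'
    have e : ∀ ρ : Fin p → Fin n, ∏ i, hInv n u (ρ i) (ρ' i)
        = ∑ t ∈ (Finset.univ : Finset (Fin p)).powerset, (∏ k ∈ t, 2 * u (ρ k) * u (ρ' k)) *
      ∏ k ∈ Finset.univ \ t, gmet n (ρ k) (ρ' k) := by
      intro ρ
      rw [← Finset.prod_add]
      refine Finset.prod_congr rfl fun k _ => ?_
      unfold hInv; ring
    simp only [e, Finset.mul_sum]
    rw [Finset.sum_comm, sum_finset_small]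
    · congr 1
      · simp
      · refine Finset.sum_congr rfl fun i _ => Finset.sum_congr rfl fun ρ _ => ?_
        have : (Finset.univ \ {i} : Finset (Fin p)) = Finset.univ.filter (fun k => k ≠ i) := by
          ext k; simp
        rw [this, Finset.prod_singleton]
        unfold uWt; ring
    · intro t i j hi hj hij
      exact vanish_two u (fun ρ => F ρ ρ') (fun i j hij ρ => h1 i j hij ρ ρ') ρ' t i j hi hj hij
  simp only [key, Finset.sum_add_distrib]
  congr 1
  rw [Finset.sum_comm]
  have hc : ∀ i : Fin p, ∑ ρ', 2 * ∑ ρ, F ρ ρ' * uWt n p u i ρ ρ'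
      = 2 * ∑ ρ', ∑ ρ, F ρ ρ' * uWt n p u ⟨0, hp⟩ ρ ρ' := by
    intro i
    rw [← Finset.mul_sum]
    congr 1
    by_cases hi : i = ⟨0, hp⟩
    · rw [hi]
    rw [← sum_swap_slot i ⟨0, hp⟩]
    refine Finset.sum_congr rfl fun ρ' _ => ?_
    rw [← sum_swap_slot i ⟨0, hp⟩]
    refine Finset.sum_congr rfl fun ρ _ => ?_
    rw [h1 _ _ hi, h2 _ _ hi, uWt_swap, neg_neg]
  simp only [hc, Finset.sum_const, Finset.card_univ, Fintype.card_fin, nsmul_eq_mul]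
  ring

/-- The bilinear contraction of `K` with itself with weights `P` and `Q`. -/
def SW (n p q : ℕ) (K : (Fin p → Fin n) → (Fin q → Fin n) → ℝ)
    (P : (Fin p → Fin n) → (Fin p → Fin n) → ℝ)
    (Q : (Fin q → Fin n) → (Fin q → Fin n) → ℝ) : ℝ :=
  ∑ ρ : Fin p → Fin n, ∑ ρ' : Fin p → Fin n, ∑ σ : Fin q → Fin n, ∑ σ' : Fin q → Fin n,
    K ρ σ * K ρ' σ' * P ρ ρ' * Q σ σ'

theorem SW_left (n p q : ℕ) (K : (Fin p → Fin n) → (Fin q → Fin n) → ℝ)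
    (P : (Fin p → Fin n) → (Fin p → Fin n) → ℝ)
    (Q : (Fin q → Fin n) → (Fin q → Fin n) → ℝ) :
    SW n p q K P Q = ∑ ρ', ∑ ρ, (∑ σ, ∑ σ', K ρ σ * K ρ' σ' * Q σ σ') * P ρ ρ' := by
  unfold SW
  rw [Finset.sum_comm]
  simp only [Finset.sum_mul]
  refine Finset.sum_congr rfl fun _ _ => Finset.sum_congr rfl fun _ _ =>
    Finset.sum_congr rfl fun _ _ => Finset.sum_congr rfl fun _ _ => ?_
  ring

theorem SW_flip (n p q : ℕ) (K : (Fin p → Fin n) → (Fin q → Fin n) → ℝ)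
    (P : (Fin p → Fin n) → (Fin p → Fin n) → ℝ)
    (Q : (Fin q → Fin n) → (Fin q → Fin n) → ℝ) :
    SW n p q K P Q = SW n q p (fun σ ρ => K ρ σ) Q P := by
  have hL : SW n p q K P Q = ∑ x : (Fin p → Fin n) × (Fin p → Fin n),
      ∑ y : (Fin q → Fin n) × (Fin q → Fin n),
        K x.1 y.1 * K x.2 y.2 * P x.1 x.2 * Q y.1 y.2 := by
    unfold SW; simp only [Fintype.sum_prod_type]
  have hR : SW n q p (fun σ ρ => K ρ σ) Q P = ∑ y : (Fin q → Fin n) × (Fin q → Fin n),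
      ∑ x : (Fin p → Fin n) × (Fin p → Fin n),
        K x.1 y.1 * K x.2 y.2 * Q y.1 y.2 * P x.1 x.2 := by
    unfold SW; simp only [Fintype.sum_prod_type]
  rw [hL, hR, Finset.sum_comm]
  refine Finset.sum_congr rfl fun _ _ => Finset.sum_congr rfl fun _ _ => ?_
  ring

theorem SW_expand {n p q : ℕ} (hp : 0 < p) (u : Fin n → ℝ)
    (K : (Fin p → Fin n) → (Fin q → Fin n) → ℝ)
    (hK : ∀ (π : Equiv.Perm (Fin p)) (ρ : Fin p → Fin n) (σ : Fin q → Fin n),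
      K (ρ ∘ π) σ = ((Equiv.Perm.sign π : ℤ) : ℝ) * K ρ σ)
    (Q : (Fin q → Fin n) → (Fin q → Fin n) → ℝ) :
    SW n p q K (fun ρ ρ' => ∏ i, hInv n u (ρ i) (ρ' i)) Q
      = SW n p q K (fun ρ ρ' => ∏ i, gmet n (ρ i) (ρ' i)) Q
        + 2 * p * SW n p q K (uWt n p u ⟨0, hp⟩) Q := by
  have hs : ∀ i j : Fin p, i ≠ j → ∀ ρ σ, K (ρ ∘ Equiv.swap i j) σ = - K ρ σ := by
    intro i j hij ρ σ
    rw [hK, Equiv.Perm.sign_swap hij]; simp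
  simp only [SW_left]
  apply block_expand hp u (fun ρ ρ' => ∑ σ, ∑ σ', K ρ σ * K ρ' σ' * Q σ σ')
  · intro i j hij ρ ρ'
    simp only [hs i j hij, neg_mul, Finset.sum_neg_distrib]
  · intro i j hij ρ ρ'
    simp only [hs i j hij, neg_mul, mul_neg, Finset.sum_neg_distrib]

theorem collapse2 {ι : Type*} [Fintype ι] {n : ℕ} (u : Fin n → ℝ) (a b : ι → Fin n) (f : ι → ℝ) :
    ∑ α, ∑ β, (∑ x, if a x = α ∧ b x = β then f x else 0) * (u α * u β)
      = ∑ x, f x * (u (a x) * u (b x)) := by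
  simp only [Finset.sum_mul]
  rw [Finset.sum_congr rfl fun α _ => Finset.sum_comm, Finset.sum_comm]
  refine Finset.sum_congr rfl fun x _ => ?_
  simp only [ite_and, ite_mul, zero_mul]
  rw [Finset.sum_comm]
  simp

theorem collapse4 {ι : Type*} [Fintype ι] {n : ℕ} (u : Fin n → ℝ) (a b c d : ι → Fin n)
    (f : ι → ℝ) :
    ∑ α, ∑ β, ∑ γ, ∑ δ, (∑ x, if a x = α ∧ b x = β ∧ c x = γ ∧ d x = δ then f x else 0)
        * (u α * u β * (u γ * u δ))
      = ∑ x, f x * (u (a x) * u (b x) * (u (c x) * u (d x))) := by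
  have h : ∀ α β, ∑ γ, ∑ δ, (∑ x, if a x = α ∧ b x = β ∧ c x = γ ∧ d x = δ then f x else 0)
        * (u α * u β * (u γ * u δ))
      = (∑ x, if a x = α ∧ b x = β then f x * (u (c x) * u (d x)) else 0) * (u α * u β) := by
    intro α β
    have h0 := collapse2 u c d (fun x => if a x = α ∧ b x = β then f x else 0)
    have h1 : (∑ x, if a x = α ∧ b x = β then f x * (u (c x) * u (d x)) else 0)
        = ∑ x, (if a x = α ∧ b x = β then f x else 0) * (u (c x) * u (d x)) := by
      simp only [ite_mul, zero_mul]
    rw [h1, ← h0, Finset.sum_mul]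
    refine Finset.sum_congr rfl fun γ _ => ?_
    rw [Finset.sum_mul]
    refine Finset.sum_congr rfl fun δ _ => ?_
    have h2 : (∑ x, if a x = α ∧ b x = β ∧ c x = γ ∧ d x = δ then f x else 0)
        = ∑ x, if c x = γ ∧ d x = δ then (if a x = α ∧ b x = β then f x else 0) else 0 := by
      refine Finset.sum_congr rfl fun x _ => ?_
      rw [← ite_and]
      congr 1
      apply propext
      tauto
    rw [h2]; ring
  simp only [h]
  rw [collapse2 u a b]
  refine Finset.sum_congr rfl fun x _ => ?_
  ring

theorem con11 (n p q : ℕ) (hp : 0 < p) (hq : 0 < q)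
    (K : (Fin p → Fin n) → (Fin q → Fin n) → ℝ) (u : Fin n → ℝ) :
    ∑ α, ∑ β, ∑ γ, ∑ δ, dCon11 n p q hp hq K α β γ δ * (u α * u β * (u γ * u δ))
      = SW n p q K (uWt n p u ⟨0, hp⟩) (uWt n q u ⟨0, hq⟩) := by
  have h := collapse4 (ι := (Fin p → Fin n) × (Fin p → Fin n) × (Fin q → Fin n) × (Fin q → Fin n))
    u (fun x => x.1 ⟨0, hp⟩) (fun x => x.2.1 ⟨0, hp⟩) (fun x => x.2.2.1 ⟨0, hq⟩)
    (fun x => x.2.2.2 ⟨0, hq⟩) (fun x => K x.1 x.2.2.1 * K x.2.1 x.2.2.2 *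
        (∏ i ∈ Finset.univ.filter (fun i => i ≠ (⟨0, hp⟩ : Fin p)), gmet n (x.1 i) (x.2.1 i)) *
        (∏ j ∈ Finset.univ.filter (fun j => j ≠ (⟨0, hq⟩ : Fin q)), gmet n (x.2.2.1 j) (x.2.2.2 j)))
  simp only [Fintype.sum_prod_type] at h
  unfold dCon11 SW uWt
  rw [h]
  refine Finset.sum_congr rfl fun _ _ => Finset.sum_congr rfl fun _ _ =>
    Finset.sum_congr rfl fun _ _ => Finset.sum_congr rfl fun _ _ => ?_
  ring

theorem con01 (n p q : ℕ) (hq : 0 < q)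
    (K : (Fin p → Fin n) → (Fin q → Fin n) → ℝ) (u : Fin n → ℝ) :
    ∑ γ, ∑ δ, dCon01 n p q hq K γ δ * (u γ * u δ)
      = SW n p q K (fun ρ ρ' => ∏ i, gmet n (ρ i) (ρ' i)) (uWt n q u ⟨0, hq⟩) := by
  have h := collapse2 (ι := (Fin p → Fin n) × (Fin p → Fin n) × (Fin q → Fin n) × (Fin q → Fin n))
    u (fun x => x.2.2.1 ⟨0, hq⟩)
    (fun x => x.2.2.2 ⟨0, hq⟩) (fun x => K x.1 x.2.2.1 * K x.2.1 x.2.2.2 *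
        (∏ i : Fin p, gmet n (x.1 i) (x.2.1 i)) *
        (∏ j ∈ Finset.univ.filter (fun j => j ≠ (⟨0, hq⟩ : Fin q)), gmet n (x.2.2.1 j) (x.2.2.2 j)))
  simp only [Fintype.sum_prod_type] at h
  unfold dCon01 SW uWt
  rw [h]
  refine Finset.sum_congr rfl fun _ _ => Finset.sum_congr rfl fun _ _ =>
    Finset.sum_congr rfl fun _ _ => Finset.sum_congr rfl fun _ _ => ?_
  ring

theorem con10 (n p q : ℕ) (hp : 0 < p)
    (K : (Fin p → Fin n) → (Fin q → Fin n) → ℝ) (u : Fin n → ℝ) :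
    ∑ α, ∑ β, dCon10 n p q hp K α β * (u α * u β)
      = SW n p q K (uWt n p u ⟨0, hp⟩) (fun σ σ' => ∏ i, gmet n (σ i) (σ' i)) := by
  have h := collapse2 (ι := (Fin p → Fin n) × (Fin p → Fin n) × (Fin q → Fin n) × (Fin q → Fin n))
    u (fun x => x.1 ⟨0, hp⟩) (fun x => x.2.1 ⟨0, hp⟩)
    (fun x => K x.1 x.2.2.1 * K x.2.1 x.2.2.2 *
        (∏ i ∈ Finset.univ.filter (fun i => i ≠ (⟨0, hp⟩ : Fin p)), gmet n (x.1 i) (x.2.1 i)) *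
        (∏ j : Fin q, gmet n (x.2.2.1 j) (x.2.2.2 j)))
  simp only [Fintype.sum_prod_type] at h
  unfold dCon10 SW uWt
  rw [h]
  refine Finset.sum_congr rfl fun _ _ => Finset.sum_congr rfl fun _ _ =>
    Finset.sum_congr rfl fun _ _ => Finset.sum_congr rfl fun _ _ => ?_
  ring

theorem sum4_mul {n : ℕ} (f g : Fin n → Fin n → ℝ) :
    ∑ α, ∑ β, ∑ γ, ∑ δ, f α β * g γ δ = (∑ α, ∑ β, f α β) * ∑ γ, ∑ δ, g γ δ := by
  simp only [← Finset.mul_sum, ← Finset.sum_mul]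

/-- the super-energy density of a double `(p,q)`-form relative to a unit
timelike `u` equals the `h`-square of `K`. -/
theorem seDensityK_eq_hSquare
    (n p q : ℕ) (hp : 1 ≤ p) (hpn : p ≤ n) (hq : 1 ≤ q) (hqn : q ≤ n)
    (K : (Fin p → Fin n) → (Fin q → Fin n) → ℝ) (hK : IsDoubleForm n p q K)
    (u : Fin n → ℝ) (hu : minkSq n u = -1) :
    (∑ α : Fin n, ∑ β : Fin n, ∑ lam : Fin n, ∑ mu : Fin n,
        seTK n p q hp hq K α β lam mu * u α * u β * u lam * u mu)
      = (1 / (2 * (p.factorial : ℝ) * (q.factorial : ℝ))) *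
          ∑ μ : Fin p → Fin n, ∑ ν : Fin p → Fin n, ∑ σ : Fin q → Fin n, ∑ τ : Fin q → Fin n,
            K μ σ * K ν τ *
              (∏ i : Fin p, hInv n u (μ i) (ν i)) * (∏ j : Fin q, hInv n u (σ j) (τ j)) := by
  have hR : (∑ μ : Fin p → Fin n, ∑ ν : Fin p → Fin n, ∑ σ : Fin q → Fin n, ∑ τ : Fin q → Fin n,
            K μ σ * K ν τ *
              (∏ i : Fin p, hInv n u (μ i) (ν i)) * (∏ j : Fin q, hInv n u (σ j) (τ j)))
      = SW n p q K (fun ρ ρ' => ∏ i, hInv n u (ρ i) (ρ' i))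
          (fun ρ ρ' => ∏ i, hInv n u (ρ i) (ρ' i)) := rfl
  have hq' : ∀ P, SW n p q K P (fun ρ ρ' => ∏ i, hInv n u (ρ i) (ρ' i))
      = SW n p q K P (fun ρ ρ' => ∏ i, gmet n (ρ i) (ρ' i))
        + 2 * q * SW n p q K P (uWt n q u ⟨0, hq⟩) := by
    intro P
    rw [SW_flip, SW_expand hq u _ (fun π ρ σ => hK.2 π σ ρ), SW_flip n p q K P (fun ρ ρ' => ∏ i, gmet n (ρ i) (ρ' i)),
      SW_flip n p q K P (uWt n q u ⟨0, hq⟩)]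
  rw [hR, SW_expand hp u K hK.1, hq', hq']
  have hg : ∑ α, ∑ β, gmet n α β * (u α * u β) = -1 := by
    rw [← hu]; unfold minkSq; simp only [mul_assoc]
  have t1 := con11 n p q hp hq K u
  have t2 : ∑ α, ∑ β, ∑ γ, ∑ δ, dCon11 n p q hp hq K α β δ γ * (u α * u β * (u γ * u δ))
      = SW n p q K (uWt n p u ⟨0, hp⟩) (uWt n q u ⟨0, hq⟩) := by
    rw [← t1]
    refine Finset.sum_congr rfl fun α _ => Finset.sum_congr rfl fun β _ => ?_
    rw [Finset.sum_comm]
    refine Finset.sum_congr rfl fun γ _ => Finset.sum_congr rfl fun δ _ => ?_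
    ring
  have t3 := sum4_mul (fun α β => gmet n α β * (u α * u β))
    (fun γ δ => dCon01 n p q hq K γ δ * (u γ * u δ))
  have t4 := sum4_mul (fun α β => dCon10 n p q hp K α β * (u α * u β))
    (fun γ δ => gmet n γ δ * (u γ * u δ))
  have t5 := sum4_mul (fun α β => gmet n α β * (u α * u β))
    (fun γ δ => gmet n γ δ * (u γ * u δ))
  simp only [hg, con01, con10] at t3 t4 t5
  have h00 : dCon00 n p q K = SW n p q K (fun ρ ρ' => ∏ i, gmet n (ρ i) (ρ' i))
      (fun ρ ρ' => ∏ i, gmet n (ρ i) (ρ' i)) := rfl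
  rw [← h00]
  have hL : (∑ α : Fin n, ∑ β : Fin n, ∑ lam : Fin n, ∑ mu : Fin n,
        seTK n p q hp hq K α β lam mu * u α * u β * u lam * u mu)
      = (1 / (((p - 1).factorial : ℝ) * ((q - 1).factorial : ℝ))) *
        ((∑ α, ∑ β, ∑ γ, ∑ δ, dCon11 n p q hp hq K α β γ δ * (u α * u β * (u γ * u δ)))
        + (∑ α, ∑ β, ∑ γ, ∑ δ, dCon11 n p q hp hq K α β δ γ * (u α * u β * (u γ * u δ)))
        - (1 / (p : ℝ)) * (∑ α, ∑ β, ∑ γ, ∑ δ,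
            gmet n α β * (u α * u β) * (dCon01 n p q hq K γ δ * (u γ * u δ)))
        - (1 / (q : ℝ)) * (∑ α, ∑ β, ∑ γ, ∑ δ,
            dCon10 n p q hp K α β * (u α * u β) * (gmet n γ δ * (u γ * u δ)))
        + (1 / (2 * (p : ℝ) * (q : ℝ))) * dCon00 n p q K * (∑ α, ∑ β, ∑ γ, ∑ δ,
            gmet n α β * (u α * u β) * (gmet n γ δ * (u γ * u δ)))) := by
    simp only [Finset.mul_sum, ← Finset.sum_add_distrib, ← Finset.sum_sub_distrib]
    refine Finset.sum_congr rfl fun _ _ => Finset.sum_congr rfl fun _ _ =>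
      Finset.sum_congr rfl fun _ _ => Finset.sum_congr rfl fun _ _ => ?_
    unfold seTK
    ring
  rw [hL, t1, t2, t3, t4, t5]
  have fp : (p.factorial : ℝ) = p * (p - 1).factorial := by
    rw [← Nat.mul_factorial_pred (by omega : p ≠ 0)]; push_cast; rfl
  have fq : (q.factorial : ℝ) = q * (q - 1).factorial := by
    rw [← Nat.mul_factorial_pred (by omega : q ≠ 0)]; push_cast; rfl
  rw [fp, fq]
  have p0 : (p : ℝ) ≠ 0 := by positivity
  have q0 : (q : ℝ) ≠ 0 := by positivity
  have pf : ((p - 1).factorial : ℝ) ≠ 0 := by positivity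
  have qf : ((q - 1).factorial : ℝ) ≠ 0 := by positivity
  field_simp
  ring
end
end
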